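/- arXiv:1805.05080 — 11 statements merged into one kernel-verified Lean document; each statement's English description precedes it below -/
import Mathlib

section
/- Theorem 1 (transform of a convolution family is a convolution family): Let s be a convolution family and let β, φ, ψ ∈ ℝ and n ∈ ℕ. Assume φ + βk ≠ 0 and ψ + βk ≠ 0 for all k ≤ n, and φ + ψ + βn ≠ 0. Then ∑_{k=0}^{n} C(n,k) · (φ/(φ+βk)) · s_k(φ+βk) · (ψ/(ψ+β(n-k))) · s_{n-k}(ψ+β(n-k)) = ((φ+ψ)/(φ+ψ+βn)) · s_n(φ+ψ+βn), where C(n,k) is the binomial coefficient. -/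
open Finset

/-- A convolution family: a sequence of polynomial functions `sₙ` with
`s₀ ≡ 1`, `sₙ(0) = 0` for `n ≥ 1`, and the binomial convolution identity
`sₙ(φ+ψ) = ∑ₖ C(n,k) sₖ(φ) s_{n-k}(ψ)` (equivalently `sₙ(φ)/n! = [xⁿ] a^φ(x)`
for some power series `a` with constant term 1). -/
structure ConvolutionFamily (s : ℕ → ℝ → ℝ) : Prop where
  isPoly : ∀ n : ℕ, ∃ p : Polynomial ℝ, ∀ x : ℝ, s n x = p.eval x
  zeroth : ∀ φ : ℝ, s 0 φ = 1
  atZero : ∀ n : ℕ, 1 ≤ n → s n 0 = 0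
  conv : ∀ (n : ℕ) (φ ψ : ℝ),
    s n (φ + ψ) = ∑ k ∈ Finset.range (n + 1), (n.choose k : ℝ) * s k φ * s (n - k) ψ


/-- exponential generating function -/
noncomputable def cfS (s : ℕ → ℝ → ℝ) (w : ℝ) : PowerSeries ℝ :=
  PowerSeries.mk fun n => s n w / n.factorial

/-- Euler operator -/
noncomputable def cfTheta (f : PowerSeries ℝ) : PowerSeries ℝ :=
  PowerSeries.X * PowerSeries.derivative ℝ f

lemma cfTheta_mul (f g : PowerSeries ℝ) :
    cfTheta (f * g) = cfTheta f * g + f * cfTheta g := by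
  simp only [cfTheta, Derivation.leibniz, smul_eq_mul]; ring

lemma coeff_cfTheta (f : PowerSeries ℝ) (n : ℕ) :
    PowerSeries.coeff n (cfTheta f) = n * PowerSeries.coeff n f := by
  cases n with
  | zero => simp [cfTheta]
  | succ n =>
    rw [cfTheta, PowerSeries.coeff_succ_X_mul,
      PowerSeries.coeff_derivative]
    push_cast; ring

lemma coeff_cfTheta_iter (f : PowerSeries ℝ) (i n : ℕ) :
    PowerSeries.coeff n (cfTheta^[i] f) = (n : ℝ) ^ i * PowerSeries.coeff n f := by
  induction i with
  | zero => simp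
  | succ i ih => rw [Function.iterate_succ_apply', coeff_cfTheta, ih]; ring

lemma cf_conv_norm {s : ℕ → ℝ → ℝ} (hs : ConvolutionFamily s) (n : ℕ) (x y : ℝ) :
    s n (x + y) / n.factorial =
      ∑ p ∈ antidiagonal n, s p.1 x / p.1.factorial * (s p.2 y / p.2.factorial) := by
  rw [hs.conv, Finset.Nat.sum_antidiagonal_eq_sum_range_succ_mk, Finset.sum_div]
  refine Finset.sum_congr rfl fun k hk => ?_
  have hk' : k ≤ n := by simpa [Nat.lt_succ_iff] using hk
  rw [Nat.cast_choose ℝ hk']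
  have := Nat.factorial_ne_zero n
  have := Nat.factorial_ne_zero k
  have := Nat.factorial_ne_zero (n-k)
  field_simp

lemma cfS_add {s : ℕ → ℝ → ℝ} (hs : ConvolutionFamily s) (x y : ℝ) :
    cfS s (x + y) = cfS s x * cfS s y := by
  ext n
  simp [cfS, PowerSeries.coeff_mul, cf_conv_norm hs]

lemma cfS_zero {s : ℕ → ℝ → ℝ} (hs : ConvolutionFamily s) : cfS s 0 = 1 := by
  ext n
  rw [PowerSeries.coeff_one]
  split_ifs with h
  · subst h; simp [cfS, hs.zeroth]
  · simp [cfS, hs.atZero n (Nat.one_le_iff_ne_zero.2 h)]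

lemma cfS_neg {s : ℕ → ℝ → ℝ} (hs : ConvolutionFamily s) (x : ℝ) :
    cfS s x * cfS s (-x) = 1 := by
  rw [← cfS_add hs, add_neg_cancel, cfS_zero hs]

/-- coefficients are polynomials of bounded degree -/
def CfDeg (i : ℕ) (f : ℝ → PowerSeries ℝ) : Prop :=
  ∀ n, ∃ p : Polynomial ℝ, p.natDegree ≤ i ∧ ∀ w, PowerSeries.coeff n (f w) = p.eval w

lemma CfDeg.theta {i : ℕ} {f : ℝ → PowerSeries ℝ} (h : CfDeg i f) :
    CfDeg i (fun w => cfTheta (f w)) := by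
  intro n
  obtain ⟨p, hp, hq⟩ := h n
  exact ⟨Polynomial.C (n : ℝ) * p, (Polynomial.natDegree_C_mul_le _ _).trans hp,
    fun w => by simp [coeff_cfTheta, hq]⟩

lemma CfDeg.add {i : ℕ} {f g : ℝ → PowerSeries ℝ} (h : CfDeg i f) (h' : CfDeg i g) :
    CfDeg i (fun w => f w + g w) := by
  intro n
  obtain ⟨p, hp, hq⟩ := h n
  obtain ⟨p', hp', hq'⟩ := h' n
  exact ⟨p + p', Polynomial.natDegree_add_le_of_degree_le hp hp',
    fun w => by simp [hq, hq']⟩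

lemma CfDeg.mono {i j : ℕ} (hij : i ≤ j) {f : ℝ → PowerSeries ℝ} (h : CfDeg i f) :
    CfDeg j f := by
  intro n
  obtain ⟨p, hp, hq⟩ := h n
  exact ⟨p, hp.trans hij, hq⟩

lemma CfDeg.mul {i j : ℕ} {f g : ℝ → PowerSeries ℝ} (h : CfDeg i f) (h' : CfDeg j g) :
    CfDeg (i + j) (fun w => f w * g w) := by
  intro n
  choose p hp hq using h
  choose p' hp' hq' using h'
  refine ⟨∑ x ∈ antidiagonal n, p x.1 * p' x.2, ?_, fun w => ?_⟩
  · exact Polynomial.natDegree_sum_le_of_forall_le _ _ fun x _ =>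
      Polynomial.natDegree_mul_le_of_le (hp _) (hp' _)
  · simp [PowerSeries.coeff_mul, Polynomial.eval_finset_sum, hq, hq']

lemma cf_additive_poly (p : Polynomial ℝ) (h : ∀ x y, p.eval (x + y) = p.eval x + p.eval y) :
    p.natDegree ≤ 1 := by
  have h0 : p.eval 0 = 0 := by have := h 0 0; simp at this; exact this
  have hn : ∀ n : ℕ, p.eval (n : ℝ) = n * p.eval 1 := by
    intro n
    induction n with
    | zero => simp [h0]
    | succ n ih => push_cast; rw [h, ih]; ring
  have : p = Polynomial.C (p.eval 1) * Polynomial.X := by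
    apply Polynomial.eq_of_infinite_eval_eq
    apply (Set.infinite_range_of_injective (Nat.cast_injective (R := ℝ))).mono
    rintro _ ⟨n, rfl⟩
    simp only [Set.mem_ofPred_eq, hn]
    simp; ring
  rw [this]
  simpa using Polynomial.natDegree_C_mul_X_pow_le (p.eval 1) 1

lemma cf_M_deg {s : ℕ → ℝ → ℝ} (hs : ConvolutionFamily s) :
    CfDeg 1 (fun w => cfTheta (cfS s w) * cfS s (-w)) := by
  have hadd : ∀ x y, cfTheta (cfS s (x + y)) * cfS s (-(x + y)) =
      cfTheta (cfS s x) * cfS s (-x) + cfTheta (cfS s y) * cfS s (-y) := by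
    intro x y
    rw [neg_add, cfS_add hs, cfS_add hs, cfTheta_mul]
    have h1 := cfS_neg hs x
    have h2 := cfS_neg hs y
    linear_combination (cfTheta (cfS s x) * cfS s (-x)) * h2 +
      (cfTheta (cfS s y) * cfS s (-y)) * h1
  intro n
  choose P hP using hs.isPoly
  let p : Polynomial ℝ := ∑ x ∈ antidiagonal n,
    (Polynomial.C (x.1 / x.1.factorial : ℝ) * P x.1) *
      (Polynomial.C (1 / x.2.factorial : ℝ) * (P x.2).comp (-Polynomial.X))
  have hp : ∀ w, PowerSeries.coeff n (cfTheta (cfS s w) * cfS s (-w)) = p.eval w := by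
    intro w
    simp only [PowerSeries.coeff_mul, p, Polynomial.eval_finset_sum, coeff_cfTheta, cfS,
      PowerSeries.coeff_mk]
    refine Finset.sum_congr rfl fun x _ => ?_
    simp [hP]; ring
  refine ⟨p, cf_additive_poly p fun x y => ?_, hp⟩
  rw [← hp, ← hp, ← hp, hadd, map_add]

lemma cf_iter_deg {s : ℕ → ℝ → ℝ} (hs : ConvolutionFamily s) (i : ℕ) :
    CfDeg i (fun w => cfTheta^[i] (cfS s w) * cfS s (-w)) := by
  induction i with
  | zero =>
    intro n
    refine ⟨Polynomial.C (PowerSeries.coeff n (1 : PowerSeries ℝ)), (Polynomial.natDegree_C _).le, fun w => ?_⟩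
    simp only [Function.iterate_zero, id, cfS_neg hs, Polynomial.eval_C]
  | succ i ih =>
    have := (ih.theta.mono (Nat.le_succ i)).add (ih.mul (cf_M_deg hs))
    convert this using 2 with w
    rw [Function.iterate_succ_apply']
    generalize hF : cfTheta^[i] (cfS s w) = F
    have h1 := cfS_neg hs w
    have h2 : cfTheta (cfS s w) * cfS s (-w) + cfS s w * cfTheta (cfS s (-w)) = 0 := by
      rw [← cfTheta_mul, h1]; simp [cfTheta]
    rw [cfTheta_mul]
    linear_combination (-F * cfS s (-w)) * h2 + F * cfTheta (cfS s (-w)) * h1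

/-- the transform, in polynomial form, divided by the factorial -/
noncomputable def cfB (P : ℕ → Polynomial ℝ) (β : ℝ) (k : ℕ) (x : ℝ) : ℝ :=
  if k = 0 then 1 else x * (P k).divX.eval (x + β * k) / k.factorial

lemma cf_moment {s : ℕ → ℝ → ℝ} (hs : ConvolutionFamily s) (P : ℕ → Polynomial ℝ)
    (hP : ∀ n x, s n x = (P n).eval x) (m i r : ℕ) (hir : i < r) :
    ∑ p ∈ antidiagonal m, (p.1 : ℝ) ^ i * ((P p.1 * (P p.2).comp (-Polynomial.X)).coeff r /
      (p.1.factorial * p.2.factorial)) = 0 := by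
  obtain ⟨q, hq, hq'⟩ := cf_iter_deg hs i m
  have : q = ∑ p ∈ antidiagonal m, Polynomial.C ((p.1 : ℝ) ^ i / (p.1.factorial * p.2.factorial)) *
      (P p.1 * (P p.2).comp (-Polynomial.X)) := by
    apply Polynomial.funext
    intro w
    rw [← hq', PowerSeries.coeff_mul, Polynomial.eval_finset_sum]
    refine Finset.sum_congr rfl fun x _ => ?_
    simp [coeff_cfTheta_iter, cfS, hP]
    field_simp
  have h2 : q.coeff r = 0 := Polynomial.coeff_eq_zero_of_natDegree_lt (hq.trans_lt hir)
  rw [this, Polynomial.finset_sum_coeff] at h2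
  rw [← h2]
  refine Finset.sum_congr rfl fun x _ => ?_
  rw [Polynomial.coeff_C_mul]; ring

lemma cf_moment' {s : ℕ → ℝ → ℝ} (hs : ConvolutionFamily s) (P : ℕ → Polynomial ℝ)
    (hP : ∀ n x, s n x = (P n).eval x) (m r : ℕ) (x β : ℝ) :
    ∑ p ∈ antidiagonal m, (x + β * p.1) ^ r *
      ((P p.1 * (P p.2).comp (-Polynomial.X)).coeff (r + 1) /
      (p.1.factorial * p.2.factorial)) = 0 := by
  simp only [add_pow, Finset.sum_mul]
  rw [Finset.sum_comm]
  refine Finset.sum_eq_zero fun j hj => ?_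
  have := cf_moment hs P hP m (r - j) (r + 1) (by omega)
  rw [← mul_zero (x ^ j * β ^ (r - j) * (r.choose j : ℝ)), ← this, Finset.mul_sum]
  refine Finset.sum_congr rfl fun p _ => ?_
  rw [mul_pow]; ring

lemma cf_divX_sum {s : ℕ → ℝ → ℝ} (hs : ConvolutionFamily s) (P : ℕ → Polynomial ℝ)
    (hP : ∀ n x, s n x = (P n).eval x) (m : ℕ) (x β : ℝ) :
    ∑ p ∈ antidiagonal m, (P p.1 * (P p.2).comp (-Polynomial.X)).divX.eval (x + β * p.1) /
      (p.1.factorial * p.2.factorial) = 0 := by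
  let N := ∑ p ∈ antidiagonal m, ((P p.1 * (P p.2).comp (-Polynomial.X)).divX.natDegree + 1)
  have hN : ∀ p ∈ antidiagonal m,
      (P p.1 * (P p.2).comp (-Polynomial.X)).divX.natDegree < N := by
    intro p hp
    have := Finset.single_le_sum
      (f := fun p : ℕ × ℕ => (P p.1 * (P p.2).comp (-Polynomial.X)).divX.natDegree + 1)
      (fun _ _ => Nat.zero_le _) hp
    exact this
  have : ∀ p ∈ antidiagonal m,
      (P p.1 * (P p.2).comp (-Polynomial.X)).divX.eval (x + β * p.1) /
      (p.1.factorial * p.2.factorial) = ∑ r ∈ Finset.range N, (x + β * p.1) ^ r *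
      ((P p.1 * (P p.2).comp (-Polynomial.X)).coeff (r + 1) /
      (p.1.factorial * p.2.factorial)) := by
    intro p hp
    rw [Polynomial.eval_eq_sum_range' (hN p hp), Finset.sum_div]
    refine Finset.sum_congr rfl fun r _ => ?_
    rw [Polynomial.coeff_divX]; ring
  rw [Finset.sum_congr rfl this, Finset.sum_comm]
  exact Finset.sum_eq_zero fun r _ => cf_moment' hs P hP m r x β

lemma cf_inner {s : ℕ → ℝ → ℝ} (hs : ConvolutionFamily s) (P : ℕ → Polynomial ℝ)
    (hP : ∀ n x, s n x = (P n).eval x) (m : ℕ) (x β : ℝ) :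
    ∑ p ∈ antidiagonal m, cfB P β p.1 x * (s p.2 (-(x + β * p.1)) / p.2.factorial) =
      if m = 0 then 1 else 0 := by
  split_ifs with hm
  · subst hm; simp [cfB, hs.zeroth]
  · have h0 : ∀ k, k ≠ 0 → (P k).coeff 0 = 0 := by
      intro k hk
      rw [Polynomial.coeff_zero_eq_eval_zero, ← hP]
      exact hs.atZero k (Nat.one_le_iff_ne_zero.2 hk)
    have h1 : P 0 = 1 := Polynomial.funext fun w => by rw [← hP, hs.zeroth]; simp
    rw [← mul_zero x, ← cf_divX_sum hs P hP m x β, Finset.mul_sum]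
    refine Finset.sum_congr rfl fun p hp => ?_
    obtain ⟨k, l⟩ := p
    have hkl : k + l = m := by simpa using hp
    dsimp only
    by_cases hk : k = 0
    · subst hk
      have hl : l ≠ 0 := by omega
      have h2 := Polynomial.divX_mul_X_add ((P l).comp (-Polynomial.X))
      have h3 := congrArg (Polynomial.eval x) h2
      have h4 : ((P l).comp (-Polynomial.X)).coeff 0 = 0 := by
        rw [Polynomial.coeff_zero_eq_eval_zero]
        simp [← hP, hs.atZero l (Nat.one_le_iff_ne_zero.2 hl)]
      rw [h4] at h3
      simp at h3
      simp [cfB, h1, hP, ← h3]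
      ring
    · have h2 := Polynomial.divX_mul_X_add (P k)
      rw [h0 k hk] at h2
      simp only [map_zero, add_zero] at h2
      have h3 : (P k * (P l).comp (-Polynomial.X)).divX =
          (P k).divX * (P l).comp (-Polynomial.X) := by
        conv_lhs => rw [← h2]
        ext j
        rw [Polynomial.coeff_divX, mul_right_comm, Polynomial.coeff_mul_X]
      rw [h3]
      simp only [cfB, if_neg hk, hP, Polynomial.eval_mul, Polynomial.eval_comp,
        Polynomial.eval_neg, Polynomial.eval_X]
      field_simp

lemma cf_A {s : ℕ → ℝ → ℝ} (hs : ConvolutionFamily s) (P : ℕ → Polynomial ℝ)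
    (hP : ∀ n x, s n x = (P n).eval x) (n : ℕ) (x y β : ℝ) :
    ∑ p ∈ antidiagonal n, cfB P β p.1 x * (s p.2 (y + β * p.2) / p.2.factorial) =
      s n (x + y + β * n) / n.factorial := by
  set z := x + y + β * n with hz
  have h1 : ∀ p ∈ antidiagonal n, cfB P β p.1 x * (s p.2 (y + β * p.2) / p.2.factorial) =
      ∑ q ∈ antidiagonal p.2, cfB P β p.1 x * (s q.1 z / q.1.factorial *
        (s q.2 (-(x + β * p.1)) / q.2.factorial)) := by
    intro p hp
    have hp' : p.1 + p.2 = n := by simpa using hp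
    have : y + β * p.2 = z + -(x + β * p.1) := by
      rw [hz, ← hp']; push_cast; ring
    rw [this, cf_conv_norm hs, Finset.mul_sum]
  rw [Finset.sum_congr rfl h1, Finset.sum_sigma']
  have h2 : s n z / n.factorial = ∑ p ∈ antidiagonal n, s p.1 z / p.1.factorial *
      ∑ q ∈ antidiagonal p.2, cfB P β q.1 x * (s q.2 (-(x + β * q.1)) / q.2.factorial) := by
    simp only [cf_inner hs P hP]
    rw [Finset.sum_eq_single (n, 0)]
    · simp
    · rintro ⟨a, b⟩ hab hne
      have : a + b = n := by simpa using hab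
      have : b ≠ 0 := by rintro rfl; apply hne; simp_all
      simp [this]
    · simp
  rw [h2]
  simp only [Finset.mul_sum]
  rw [Finset.sum_sigma']
  refine Finset.sum_nbij' (fun a => ⟨(a.2.1, a.1.1 + a.2.2), (a.1.1, a.2.2)⟩)
    (fun a => ⟨(a.2.1, a.1.1 + a.2.2), (a.1.1, a.2.2)⟩) ?_ ?_ ?_ ?_ ?_
  · rintro ⟨⟨a, b⟩, ⟨c, d⟩⟩ h
    simp at h ⊢; omega
  · rintro ⟨⟨a, b⟩, ⟨c, d⟩⟩ h
    simp at h ⊢; omega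
  · rintro ⟨⟨a, b⟩, ⟨c, d⟩⟩ h
    simp at h ⊢; exact h.2
  · rintro ⟨⟨a, b⟩, ⟨c, d⟩⟩ h
    simp at h ⊢; exact h.2
  · rintro ⟨⟨a, b⟩, ⟨c, d⟩⟩ h
    simp only; ring

lemma cf_B_conv {s : ℕ → ℝ → ℝ} (hs : ConvolutionFamily s) (P : ℕ → Polynomial ℝ)
    (hP : ∀ n x, s n x = (P n).eval x) (n : ℕ) (x y β : ℝ) :
    ∑ p ∈ antidiagonal n, cfB P β p.1 x * cfB P β p.2 y = cfB P β n (x + y) := by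
  let T : ℝ → PowerSeries ℝ := fun x => PowerSeries.mk fun k => cfB P β k x
  let U : ℝ → PowerSeries ℝ := fun y => PowerSeries.mk fun k => s k (y + β * k) / k.factorial
  have hTU : ∀ x y, T x * U y = U (x + y) := by
    intro x y
    ext n
    simp only [PowerSeries.coeff_mul, T, U, PowerSeries.coeff_mk]
    exact cf_A hs P hP n x y β
  have hU : U 0 ≠ 0 := by
    intro h
    have := congrArg (PowerSeries.coeff 0) h
    simp [U, hs.zeroth] at this
  have hT : T x * T y = T (x + y) := by
    apply mul_right_cancel₀ hU
    rw [mul_assoc, hTU, hTU, hTU, add_assoc]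
  have := congrArg (PowerSeries.coeff n) hT
  simpa only [PowerSeries.coeff_mul, T, PowerSeries.coeff_mk] using this

lemma cfB_eq {s : ℕ → ℝ → ℝ} (hs : ConvolutionFamily s) (P : ℕ → Polynomial ℝ)
    (hP : ∀ n x, s n x = (P n).eval x) (k : ℕ) (x β : ℝ) (h : x + β * k ≠ 0) :
    x / (x + β * k) * s k (x + β * k) = k.factorial * cfB P β k x ∨ (k = 0) := by
  by_cases hk : k = 0
  · exact Or.inr hk
  left
  have h2 := congrArg (Polynomial.eval (x + β * k)) (Polynomial.divX_mul_X_add (P k))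
  have h0 : (P k).coeff 0 = 0 := by
    rw [Polynomial.coeff_zero_eq_eval_zero, ← hP]
    exact hs.atZero k (Nat.one_le_iff_ne_zero.2 hk)
  rw [h0] at h2
  simp only [map_zero, add_zero, Polynomial.eval_mul, Polynomial.eval_X] at h2
  rw [hP, ← h2, cfB, if_neg hk]
  have := Nat.factorial_ne_zero k
  field_simp

lemma cfB_eq' {s : ℕ → ℝ → ℝ} (hs : ConvolutionFamily s) (P : ℕ → Polynomial ℝ)
    (hP : ∀ n x, s n x = (P n).eval x) (k : ℕ) (x β : ℝ) (h : x + β * k ≠ 0) :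
    x / (x + β * k) * s k (x + β * k) = k.factorial * cfB P β k x := by
  rcases cfB_eq hs P hP k x β h with h1 | rfl
  · exact h1
  · have hx : x ≠ 0 := by simpa using h
    simp [cfB, hs.zeroth, hx]

/-- Theorem 1: the transform `sₙ(φ) ↦ (φ/(φ+βn)) sₙ(φ+βn)` of a convolution
family again satisfies the binomial convolution identity. -/
theorem transform_convolution_family (s : ℕ → ℝ → ℝ) (hs : ConvolutionFamily s)
    (β φ ψ : ℝ) (n : ℕ)
    (hφ : ∀ k : ℕ, k ≤ n → φ + β * k ≠ 0)
    (hψ : ∀ k : ℕ, k ≤ n → ψ + β * k ≠ 0)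
    (hφψ : φ + ψ + β * n ≠ 0) :
    ∑ k ∈ Finset.range (n + 1),
        (n.choose k : ℝ) * (φ / (φ + β * k)) * s k (φ + β * k) *
          (ψ / (ψ + β * (n - k : ℕ))) * s (n - k) (ψ + β * (n - k : ℕ)) =
      ((φ + ψ) / (φ + ψ + β * n)) * s n (φ + ψ + β * n) := by
  choose P hP using hs.isPoly
  rw [cfB_eq' hs P hP n (φ + ψ) β hφψ, ← cf_B_conv hs P hP,
    Finset.Nat.sum_antidiagonal_eq_sum_range_succ_mk, Finset.mul_sum]
  refine Finset.sum_congr rfl fun k hk => ?_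
  have hk' : k ≤ n := by simpa [Nat.lt_succ_iff] using hk
  have e1 := cfB_eq' hs P hP k φ β (hφ k hk')
  have e2 := cfB_eq' hs P hP (n - k) ψ β (hψ (n - k) (Nat.sub_le _ _))
  have e3 : (n.choose k : ℝ) * k.factorial * (n - k).factorial = n.factorial := by
    exact_mod_cast Nat.choose_mul_factorial_mul_factorial hk'
  calc _ = (n.choose k : ℝ) * (φ / (φ + β * k) * s k (φ + β * k)) *
          (ψ / (ψ + β * (n - k : ℕ)) * s (n - k) (ψ + β * (n - k : ℕ))) := by ring
    _ = _ := by rw [e1, e2, ← e3]; ring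
end

section
/- Direct Lagrange relation for convolution polynomials: Let s be a convolution family. Then for every m ≥ 1 and all a, φ ∈ ℝ: m · φ · s_m(φ + m·a) = (φ + m·a) · ∑_{k=0}^{m} C(m,k) · k · s_k(φ) · s_{m-k}(m·a), where C(m,k) is the binomial coefficient. -/
open Finset

/-- The exponential generating function of the family at `φ`. -/
noncomputable def egfS (s : ℕ → ℝ → ℝ) (φ : ℝ) : PowerSeries ℝ :=
  PowerSeries.mk fun n => s n φ / (n.factorial : ℝ)

/-- `x d/dx` of the exponential generating function. -/
noncomputable def egfD (s : ℕ → ℝ → ℝ) (φ : ℝ) : PowerSeries ℝ :=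
  PowerSeries.X * PowerSeries.derivative ℝ (egfS s φ)

lemma coeff_egfD (s : ℕ → ℝ → ℝ) (φ : ℝ) (n : ℕ) :
    PowerSeries.coeff n (egfD s φ) = n * s n φ / (n.factorial : ℝ) := by
  cases n with
  | zero => simp [egfD]
  | succ n =>
    rw [egfD, PowerSeries.coeff_succ_X_mul, PowerSeries.coeff_derivative]
    simp only [egfS, PowerSeries.coeff_mk]
    push_cast
    ring

lemma egfS_add (s : ℕ → ℝ → ℝ) (hs : ConvolutionFamily s) (φ ψ : ℝ) :
    egfS s (φ + ψ) = egfS s φ * egfS s ψ := by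
  ext n
  rw [PowerSeries.coeff_mul, Finset.Nat.sum_antidiagonal_eq_sum_range_succ_mk]
  simp only [egfS, PowerSeries.coeff_mk]
  rw [hs.conv, Finset.sum_div]
  refine Finset.sum_congr rfl fun k hk => ?_
  have hk' : k ≤ n := by simpa [Nat.lt_succ_iff] using hk
  rw [Nat.cast_choose ℝ hk']
  have := Nat.factorial_ne_zero n
  have := Nat.factorial_ne_zero k
  have := Nat.factorial_ne_zero (n - k)
  field_simp

lemma egfS_zero (s : ℕ → ℝ → ℝ) (hs : ConvolutionFamily s) : egfS s 0 = 1 := by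
  ext n
  rcases Nat.eq_zero_or_pos n with rfl | h
  · simp [egfS, hs.zeroth]
  · simp [egfS, hs.atZero n h, PowerSeries.coeff_one, h.ne']

lemma egfD_add (s : ℕ → ℝ → ℝ) (hs : ConvolutionFamily s) (φ ψ : ℝ) :
    egfD s (φ + ψ) = egfD s φ * egfS s ψ + egfS s φ * egfD s ψ := by
  simp only [egfD, egfS_add s hs, Derivation.leibniz, smul_eq_mul]
  ring

lemma egfS_neg (s : ℕ → ℝ → ℝ) (hs : ConvolutionFamily s) (φ : ℝ) :
    egfS s φ * egfS s (-φ) = 1 := by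
  rw [← egfS_add s hs, add_neg_cancel, egfS_zero s hs]

lemma logD_add (s : ℕ → ℝ → ℝ) (hs : ConvolutionFamily s) (φ ψ : ℝ) :
    egfD s (φ + ψ) * egfS s (-(φ + ψ)) =
      egfD s φ * egfS s (-φ) + egfD s ψ * egfS s (-ψ) := by
  rw [egfD_add s hs, neg_add, egfS_add s hs]
  linear_combination (egfD s φ * egfS s (-φ)) * egfS_neg s hs ψ +
    (egfD s ψ * egfS s (-ψ)) * egfS_neg s hs φ

lemma cont_fam (s : ℕ → ℝ → ℝ) (hs : ConvolutionFamily s) (n : ℕ) : Continuous (s n) := by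
  obtain ⟨p, hp⟩ := hs.isPoly n
  rw [funext hp]
  exact p.continuous

lemma logD_linear (s : ℕ → ℝ → ℝ) (hs : ConvolutionFamily s) (φ : ℝ) :
    egfD s φ * egfS s (-φ) = PowerSeries.C φ * (egfD s 1 * egfS s (-1)) := by
  ext n
  let f : ℝ →+ ℝ := AddMonoidHom.mk' (fun x => PowerSeries.coeff n (egfD s x * egfS s (-x)))
    (fun x y => by rw [logD_add s hs, map_add])
  have hf : Continuous f := by
    change Continuous (fun x => PowerSeries.coeff n (egfD s x * egfS s (-x)))
    simp only [PowerSeries.coeff_mul, coeff_egfD, egfS, PowerSeries.coeff_mk]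
    have := cont_fam s hs
    fun_prop
  have h := map_real_smul f hf φ 1
  rw [PowerSeries.coeff_C_mul]
  simpa [f] using h

lemma egfD_eq (s : ℕ → ℝ → ℝ) (hs : ConvolutionFamily s) (φ : ℝ) :
    egfD s φ = PowerSeries.C φ * (egfD s 1 * egfS s (-1)) * egfS s φ := by
  rw [← logD_linear s hs]
  linear_combination (-egfD s φ) * egfS_neg s hs φ

lemma egf_relation (s : ℕ → ℝ → ℝ) (hs : ConvolutionFamily s) (φ ψ : ℝ) :
    PowerSeries.C φ * egfD s (φ + ψ) = PowerSeries.C (φ + ψ) * (egfD s φ * egfS s ψ) := by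
  rw [egfD_eq s hs (φ + ψ), egfD_eq s hs φ, egfS_add s hs]
  ring

/-- Direct Lagrange relation for convolution polynomials:
`m·φ·s_m(φ+ma) = (φ+ma)·∑ₖ C(m,k)·k·sₖ(φ)·s_{m-k}(ma)`. -/
theorem direct_lagrange_relation (s : ℕ → ℝ → ℝ) (hs : ConvolutionFamily s)
    (m : ℕ) (hm : 1 ≤ m) (a φ : ℝ) :
    (m : ℝ) * φ * s m (φ + m * a) =
      (φ + m * a) *
        ∑ k ∈ Finset.range (m + 1),
          (m.choose k : ℝ) * k * s k φ * s (m - k) (m * a) := by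
  have h := congrArg (PowerSeries.coeff m) (egf_relation s hs φ (m * a))
  rw [PowerSeries.coeff_C_mul, PowerSeries.coeff_C_mul, PowerSeries.coeff_mul,
    Finset.Nat.sum_antidiagonal_eq_sum_range_succ_mk] at h
  simp only [coeff_egfD, egfS, PowerSeries.coeff_mk] at h
  have hm0 : (m.factorial : ℝ) ≠ 0 := by exact_mod_cast Nat.factorial_ne_zero m
  have e : ∑ k ∈ Finset.range (m + 1), (m.choose k : ℝ) * k * s k φ * s (m - k) (m * a) =
      (m.factorial : ℝ) * ∑ k ∈ Finset.range (m + 1),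
        (k * s k φ / (k.factorial : ℝ)) * (s (m - k) (m * a) / ((m - k).factorial : ℝ)) := by
    rw [Finset.mul_sum]
    refine Finset.sum_congr rfl fun k hk => ?_
    have hk' : k ≤ m := by simpa [Nat.lt_succ_iff] using hk
    rw [Nat.cast_choose ℝ hk']
    have := Nat.factorial_ne_zero k
    have := Nat.factorial_ne_zero (m - k)
    field_simp
  rw [e, mul_left_comm, ← h]
  field_simp
end

section
/- Inverse Lagrange relation for convolution polynomials: Let s be a convolution family, let m ∈ ℕ, a ∈ ℝ, and let φ ∈ ℝ satisfy φ + k·a ≠ 0 for all k ≤ m (in particular φ ≠ 0). Then s_m(φ) = ∑_{k=0}^{m} C(m,k) · (φ/(φ + k·a)) · s_k(φ + k·a) · s_{m-k}(-k·a), where C(m,k) is the binomial coefficient. -/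
open Finset

/-- Reassociation of sums over triples. -/
lemma ilr_assoc (f : ℕ → ℕ → ℕ → ℝ) (m : ℕ) :
    ∑ p ∈ antidiagonal m, ∑ q ∈ antidiagonal p.1, f q.1 q.2 p.2 =
      ∑ p ∈ antidiagonal m, ∑ q ∈ antidiagonal p.2, f p.1 q.1 q.2 := by
  rw [Finset.sum_sigma', Finset.sum_sigma']
  refine Finset.sum_nbij' (fun x => ⟨(x.2.1, x.2.2 + x.1.2), (x.2.2, x.1.2)⟩)
    (fun x => ⟨(x.1.1 + x.2.1, x.2.2), (x.1.1, x.2.1)⟩) ?_ ?_ ?_ ?_ ?_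
  · rintro ⟨⟨a, b⟩, ⟨c, d⟩⟩ h
    simp at h ⊢
    omega
  · rintro ⟨⟨a, b⟩, ⟨c, d⟩⟩ h
    simp at h ⊢
    omega
  · rintro ⟨⟨a, b⟩, ⟨c, d⟩⟩ h
    simp at h ⊢
    omega
  · rintro ⟨⟨a, b⟩, ⟨c, d⟩⟩ h
    simp at h ⊢
    omega
  · rintro ⟨⟨a, b⟩, ⟨c, d⟩⟩ h
    rfl

/-- The mixed sum. -/
noncomputable def ilrF (S : ℝ → PowerSeries ℝ) (V : PowerSeries ℝ) (a φ ψ : ℝ) (m : ℕ) : ℝ :=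
  ∑ p ∈ antidiagonal m, PowerSeries.coeff p.1 (V * S (φ + p.1 * a)) *
    PowerSeries.coeff p.2 (S (ψ - p.1 * a))

lemma ilrF_left (S : ℝ → PowerSeries ℝ) (hS : ∀ x y, S (x + y) = S x * S y)
    (V : PowerSeries ℝ) (a φ ψ h : ℝ) (m : ℕ) :
    ilrF S V a (φ + h) ψ m = ∑ p ∈ antidiagonal m, PowerSeries.coeff p.1 (S h) *
      ilrF S V a (φ + p.1 * a) (ψ - p.1 * a) p.2 := by
  have e := ilr_assoc (fun i j l => PowerSeries.coeff i (S h) *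
    (PowerSeries.coeff j (V * S (φ + i * a + j * a)) *
      PowerSeries.coeff l (S (ψ - i * a - j * a)))) m
  simp only [ilrF, Finset.mul_sum]
  rw [← e]
  refine Finset.sum_congr rfl fun p _ => ?_
  have : V * S (φ + h + p.1 * a) = S h * (V * S (φ + p.1 * a)) := by
    rw [show φ + h + p.1 * a = h + (φ + p.1 * a) by ring, hS]; ring
  rw [this, PowerSeries.coeff_mul, Finset.sum_mul]
  refine Finset.sum_congr rfl fun q hq => ?_
  rw [← mem_antidiagonal.1 hq]
  push_cast
  rw [show φ + ((q.1 : ℝ) + q.2) * a = φ + q.1 * a + q.2 * a by ring,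
    show ψ - ((q.1 : ℝ) + q.2) * a = ψ - q.1 * a - q.2 * a by ring]
  ring

lemma ilrF_right (S : ℝ → PowerSeries ℝ) (hS : ∀ x y, S (x + y) = S x * S y)
    (V : PowerSeries ℝ) (a φ ψ h : ℝ) (m : ℕ) :
    ilrF S V a φ (ψ + h) m = ∑ p ∈ antidiagonal m, PowerSeries.coeff p.1 (S h) *
      ilrF S V a φ ψ p.2 := by
  have e := ilr_assoc (fun i j l => PowerSeries.coeff i (V * S (φ + i * a)) *
      PowerSeries.coeff j (S (ψ - i * a)) * PowerSeries.coeff l (S h)) m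
  rw [← Finset.Nat.sum_antidiagonal_swap]
  simp only [ilrF, Finset.mul_sum, Prod.fst_swap, Prod.snd_swap]
  simp only [mul_comm (PowerSeries.coeff _ (S h))]
  rw [e]
  refine Finset.sum_congr rfl fun p _ => ?_
  rw [show ψ + h - p.1 * a = (ψ - p.1 * a) + h by ring, hS (ψ - p.1 * a) h,
    PowerSeries.coeff_mul _ (S (ψ - p.1 * a)) (S h), Finset.mul_sum]
  refine Finset.sum_congr rfl fun q hq => ?_
  ring

lemma ilrF_shift (S : ℝ → PowerSeries ℝ) (hS : ∀ x y, S (x + y) = S x * S y)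
    (V : PowerSeries ℝ) (a : ℝ) (m : ℕ) : ∀ φ ψ h : ℝ,
    ilrF S V a (φ + h) ψ m = ilrF S V a φ (ψ + h) m := by
  induction m using Nat.strong_induction_on with
  | _ m ih =>
    intro φ ψ h
    rw [ilrF_left S hS, ilrF_right S hS]
    refine Finset.sum_congr rfl fun p hp => ?_
    have hp := mem_antidiagonal.1 hp
    by_cases h0 : p.1 = 0
    · simp [h0]
    · rw [ih p.2 (by omega), sub_add_cancel]

/-- The exponential generating function. -/
noncomputable def ilrS (s : ℕ → ℝ → ℝ) (x : ℝ) : PowerSeries ℝ :=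
  PowerSeries.mk fun n => s n x / n.factorial

lemma ilrS_add (s : ℕ → ℝ → ℝ) (hs : ConvolutionFamily s) (x y : ℝ) :
    ilrS s (x + y) = ilrS s x * ilrS s y := by
  ext n
  rw [PowerSeries.coeff_mul, Finset.Nat.sum_antidiagonal_eq_sum_range_succ_mk]
  simp only [ilrS, PowerSeries.coeff_mk]
  rw [hs.conv, Finset.sum_div]
  refine Finset.sum_congr rfl fun k hk => ?_
  have hk : k ≤ n := by simpa [Nat.lt_succ_iff] using hk
  rw [Nat.cast_choose ℝ hk]
  have := Nat.factorial_ne_zero n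
  field_simp

lemma ilrS_zero (s : ℕ → ℝ → ℝ) (hs : ConvolutionFamily s) : ilrS s 0 = 1 := by
  ext n
  rcases n with _ | n
  · simp [ilrS, hs.zeroth]
  · simp [ilrS, PowerSeries.coeff_one, hs.atZero]

open PowerSeries in
lemma ilr_log (s : ℕ → ℝ → ℝ) (hs : ConvolutionFamily s) :
    ∃ L : PowerSeries ℝ, ∀ x : ℝ, d⁄dX ℝ (ilrS s x) = x • (L * ilrS s x) := by
  have hinv : ∀ x, ilrS s x * ilrS s (-x) = 1 := fun x => by
    rw [← ilrS_add s hs, add_neg_cancel, ilrS_zero s hs]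
  set E : ℝ → PowerSeries ℝ := fun x => d⁄dX ℝ (ilrS s x) * ilrS s (-x) with hE
  have hadd : ∀ x y, E (x + y) = E x + E y := by
    intro x y
    simp only [hE]
    rw [neg_add, ilrS_add s hs, ilrS_add s hs, Derivation.leibniz, smul_eq_mul, smul_eq_mul]
    linear_combination (d⁄dX ℝ (ilrS s y) * ilrS s (-y)) * hinv x +
      (d⁄dX ℝ (ilrS s x) * ilrS s (-x)) * hinv y
  have hcs : ∀ n, Continuous (s n) := fun n => by
    obtain ⟨p, hp⟩ := hs.isPoly n
    rw [show s n = fun x => p.eval x from funext hp]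
    exact p.continuous
  have hlin : ∀ x, E x = x • E 1 := by
    intro x
    ext n
    let f : ℝ →+ ℝ := AddMonoidHom.mk' (fun x => coeff n (E x)) (fun x y => by
      simp [hadd])
    have hf : Continuous f := by
      change Continuous (fun x => coeff n (E x))
      simp only [hE, coeff_mul, coeff_derivative, ilrS, coeff_mk]
      fun_prop
    have := map_real_smul f hf x 1
    simpa [f] using this
  refine ⟨E 1, fun x => ?_⟩
  rw [← smul_mul_assoc, ← hlin]
  simp only [hE]
  linear_combination -(d⁄dX ℝ (ilrS s x)) * hinv x

/-- Inverse Lagrange relation for convolution polynomials: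
`s_m(φ) = ∑ₖ C(m,k)·(φ/(φ+ka))·sₖ(φ+ka)·s_{m-k}(-ka)`. -/
theorem inverse_lagrange_relation (s : ℕ → ℝ → ℝ) (hs : ConvolutionFamily s)
    (m : ℕ) (a φ : ℝ) (hφ : ∀ k : ℕ, k ≤ m → φ + k * a ≠ 0) :
    s m φ =
      ∑ k ∈ Finset.range (m + 1),
        (m.choose k : ℝ) * (φ / (φ + k * a)) * s k (φ + k * a) * s (m - k) (-(k * a)) := by
  obtain ⟨L, hL⟩ := ilr_log s hs
  set V : PowerSeries ℝ := 1 - a • (PowerSeries.X * L) with hV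
  -- the basic coefficient identity
  have key : ∀ (k : ℕ) (x : ℝ), x * PowerSeries.coeff k (V * ilrS s x) =
      (x - k * a) * (s k x / k.factorial) := by
    intro k x
    have h1 : x • (V * ilrS s x) =
        x • ilrS s x - a • (PowerSeries.X * PowerSeries.derivative ℝ (ilrS s x)) := by
      rw [hL, hV]
      simp only [sub_mul, one_mul, smul_sub, smul_mul_assoc, mul_smul_comm, mul_assoc]
      rw [smul_comm]
    have h2 := congrArg (PowerSeries.coeff k) h1
    simp only [map_sub, PowerSeries.coeff_smul, smul_eq_mul] at h2
    rw [h2]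
    rcases k with _ | k
    · simp [ilrS]
    · rw [PowerSeries.coeff_succ_X_mul, PowerSeries.coeff_derivative]
      simp only [ilrS, PowerSeries.coeff_mk]
      push_cast
      ring
  have hshift := ilrF_shift (ilrS s) (ilrS_add s hs) V a m 0 0 φ
  rw [zero_add] at hshift
  -- evaluation at `(0, φ)`
  have hR : ilrF (ilrS s) V a 0 φ m = s m φ / m.factorial := by
    unfold ilrF
    rw [Finset.Nat.sum_antidiagonal_eq_sum_range_succ_mk, Finset.sum_eq_single 0]
    · simp [ilrS, hV, hs.zeroth]
    · intro k _ hk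
      have hz : PowerSeries.coeff k (V * ilrS s (0 + k * a)) = 0 := by
        rw [zero_add]
        by_cases ha : a = 0
        · simp [hV, ha, ilrS_zero s hs, PowerSeries.coeff_one, hk]
        · have := key k (k * a)
          rw [sub_self, zero_mul] at this
          have hk' : (k : ℝ) ≠ 0 := by exact_mod_cast hk
          exact (mul_eq_zero.1 this).resolve_left (mul_ne_zero hk' ha)
      simp only [hz, zero_mul]
    · simp
  rw [hR] at hshift
  have hm : (m.factorial : ℝ) ≠ 0 := by exact_mod_cast Nat.factorial_ne_zero m
  have h3 : s m φ = m.factorial * ilrF (ilrS s) V a φ 0 m := by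
    rw [hshift]; field_simp
  rw [h3]
  unfold ilrF
  rw [Finset.Nat.sum_antidiagonal_eq_sum_range_succ_mk, Finset.mul_sum]
  refine Finset.sum_congr rfl fun k hk => ?_
  have hk : k ≤ m := by simpa [Nat.lt_succ_iff] using hk
  have hx := hφ k hk
  have hc : PowerSeries.coeff k (V * ilrS s (φ + k * a)) =
      φ / (φ + k * a) * (s k (φ + k * a) / k.factorial) := by
    have := key k (φ + k * a)
    rw [add_sub_cancel_right] at this
    rw [div_mul_eq_mul_div, eq_div_iff hx, ← this, mul_comm]
  simp only [hc]
  rw [zero_sub, Nat.cast_choose ℝ hk]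
  simp only [ilrS, PowerSeries.coeff_mk]
  have h4 := Nat.factorial_ne_zero k
  have h5 := Nat.factorial_ne_zero (m - k)
  field_simp
end

section
/- Theorem 2, part 1 (the composition operator respects Dirichlet multiplication): Let A : ℝ → ArithmeticFunction ℝ satisfy A(0) = 1 (the identity of Dirichlet convolution) and A(x+y) = A(x) * A(y) for all x, y ∈ ℝ. Define the operator T_A on arithmetic functions by (T_A g)(n) = ∑_{d | n} g(d) · (A(log d))(n/d) for n ≥ 1. Then for all arithmetic functions f, g: T_A(f * g) = (T_A f) * (T_A g), where * is Dirichlet convolution. -/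
open Finset ArithmeticFunction

/-- The Riordan–Dirichlet composition operator `⟨1, a(s)⟩` associated with a
one-parameter family `A` of arithmetic functions (playing the role of the real
powers `a^φ(s)`): `(T_A g)(n) = ∑_{d ∣ n} g(d) · (A(log d))(n/d)`. -/
noncomputable def dirichletComp (A : ℝ → ArithmeticFunction ℝ)
    (g : ArithmeticFunction ℝ) : ArithmeticFunction ℝ :=
  ⟨fun n => ∑ d ∈ n.divisors, g d * (A (Real.log d)) (n / d), by simp⟩

/-- Theorem 2, part 1: the composition operator `T_A` respects Dirichlet
multiplication. -/
theorem dirichletComp_mul (A : ℝ → ArithmeticFunction ℝ)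
    (hA0 : A 0 = 1) (hAadd : ∀ x y : ℝ, A (x + y) = A x * A y)
    (f g : ArithmeticFunction ℝ) :
    dirichletComp A (f * g) = dirichletComp A f * dirichletComp A g := by
  ext n
  have key : ∀ (h : ArithmeticFunction ℝ) (m : ℕ), dirichletComp A h m =
      ∑ p ∈ m.divisorsAntidiagonal, h p.1 * A (Real.log p.1) p.2 := by
    intro h m
    exact (Nat.sum_divisorsAntidiagonal (fun d e => h d * A (Real.log d) e)).symm
  have L : dirichletComp A (f * g) n = ∑ p ∈ n.divisorsAntidiagonal,
      ∑ q ∈ p.1.divisorsAntidiagonal, ∑ r ∈ p.2.divisorsAntidiagonal,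
        (f q.1 * g q.2) * (A (Real.log q.1) r.1 * A (Real.log q.2) r.2) := by
    rw [key]
    refine Finset.sum_congr rfl fun p _ => ?_
    rw [ArithmeticFunction.mul_apply, Finset.sum_mul]
    refine Finset.sum_congr rfl fun q hq => ?_
    obtain ⟨h1, h2⟩ := Nat.mem_divisorsAntidiagonal.1 hq
    have ha : (q.1 : ℝ) ≠ 0 := by
      intro h
      exact h2 (by rw [← h1, Nat.cast_eq_zero.1 h, zero_mul])
    have hb : (q.2 : ℝ) ≠ 0 := by
      intro h
      exact h2 (by rw [← h1, Nat.cast_eq_zero.1 h, mul_zero])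
    rw [← h1, Nat.cast_mul, Real.log_mul ha hb, hAadd, ArithmeticFunction.mul_apply,
      Finset.mul_sum]
  have R : (dirichletComp A f * dirichletComp A g) n = ∑ p ∈ n.divisorsAntidiagonal,
      ∑ q ∈ p.1.divisorsAntidiagonal, ∑ r ∈ p.2.divisorsAntidiagonal,
        (f q.1 * A (Real.log q.1) q.2) * (g r.1 * A (Real.log r.1) r.2) := by
    rw [ArithmeticFunction.mul_apply]
    refine Finset.sum_congr rfl fun p _ => ?_
    rw [key, key, Finset.sum_mul_sum]
  rw [L, R]
  simp only [Finset.sum_sigma']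
  refine Finset.sum_nbij'
    (fun x => ⟨(x.2.1.1 * x.2.2.1, x.2.1.2 * x.2.2.2), (x.2.1.1, x.2.2.1), (x.2.1.2, x.2.2.2)⟩)
    (fun x => ⟨(x.2.1.1 * x.2.2.1, x.2.1.2 * x.2.2.2), (x.2.1.1, x.2.2.1), (x.2.1.2, x.2.2.2)⟩)
    ?_ ?_ ?_ ?_ ?_
  · rintro ⟨⟨d, e⟩, ⟨a, b⟩, ⟨u, v⟩⟩ h
    simp only [Finset.mem_sigma, Nat.mem_divisorsAntidiagonal] at h ⊢
    obtain ⟨⟨h1, h2⟩, ⟨h3, h4⟩, h5, h6⟩ := h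
    subst h3 h5
    simp only [ne_eq, mul_eq_zero, not_or] at h4 h6 ⊢
    refine ⟨⟨by rw [← h1]; ring, h2⟩, ⟨trivial, h4.1, h6.1⟩, trivial, h4.2, h6.2⟩
  · rintro ⟨⟨d, e⟩, ⟨a, b⟩, ⟨u, v⟩⟩ h
    simp only [Finset.mem_sigma, Nat.mem_divisorsAntidiagonal] at h ⊢
    obtain ⟨⟨h1, h2⟩, ⟨h3, h4⟩, h5, h6⟩ := h
    subst h3 h5
    simp only [ne_eq, mul_eq_zero, not_or] at h4 h6 ⊢
    refine ⟨⟨by rw [← h1]; ring, h2⟩, ⟨trivial, h4.1, h6.1⟩, trivial, h4.2, h6.2⟩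
  · rintro ⟨⟨d, e⟩, ⟨a, b⟩, ⟨u, v⟩⟩ h
    simp only [Finset.mem_sigma, Nat.mem_divisorsAntidiagonal] at h ⊢
    obtain ⟨⟨h1, h2⟩, ⟨h3, h4⟩, h5, h6⟩ := h
    subst h3 h5
    rfl
  · rintro ⟨⟨d, e⟩, ⟨a, b⟩, ⟨u, v⟩⟩ h
    simp only [Finset.mem_sigma, Nat.mem_divisorsAntidiagonal] at h ⊢
    obtain ⟨⟨h1, h2⟩, ⟨h3, h4⟩, h5, h6⟩ := h
    subst h3 h5
    rfl
  · rintro ⟨⟨d, e⟩, ⟨a, b⟩, ⟨u, v⟩⟩ _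
    dsimp only
    ring
end

section
/- Theorem 2, part 2 (composition rule for Riordan–Dirichlet operators): Let A, B : ℝ → ArithmeticFunction ℝ each satisfy A(0) = 1, A(x+y) = A(x)*A(y) and B(0) = 1, B(x+y) = B(x)*B(y) for all x, y ∈ ℝ. Define T_A and T_B by (T_A g)(n) = ∑_{d | n} g(d) · (A(log d))(n/d), and define C : ℝ → ArithmeticFunction ℝ by C(φ) = A(φ) * T_A(B(φ)). Then for every arithmetic function f: T_A(T_B f) = T_C f. (This is the rule ⟨1,a(s)⟩⟨1,b(s)⟩ = ⟨1, a(s)(b(s)∘a(s))⟩.) -/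
open Finset ArithmeticFunction

lemma dirichletComp_apply_anti (A : ℝ → ArithmeticFunction ℝ) (g : ArithmeticFunction ℝ) (n : ℕ) :
    dirichletComp A g n = ∑ p ∈ n.divisorsAntidiagonal, g p.1 * (A (Real.log p.1)) p.2 := by
  rw [Nat.sum_divisorsAntidiagonal (f := fun a b => g a * (A (Real.log a)) b)]
  rfl

lemma sum_anti_assoc (F : ℕ → ℕ → ℕ → ℝ) (n : ℕ) :
    ∑ p ∈ n.divisorsAntidiagonal, ∑ q ∈ p.1.divisorsAntidiagonal, F q.1 q.2 p.2 =
    ∑ p ∈ n.divisorsAntidiagonal, ∑ q ∈ p.2.divisorsAntidiagonal, F p.1 q.1 q.2 := by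
  simp only [Finset.sum_sigma']
  apply Finset.sum_nbij' (fun ⟨⟨_i, j⟩, ⟨k, l⟩⟩ ↦ ⟨(k, l * j), (l, j)⟩)
    (fun ⟨⟨i, _j⟩, ⟨k, l⟩⟩ ↦ ⟨(i * k, l), (i, k)⟩) <;>
    simp +contextual [Nat.mem_divisorsAntidiagonal, mul_assoc] <;> grind

lemma sum_anti_left_comm (F : ℕ → ℕ → ℕ → ℝ) (n : ℕ) :
    ∑ p ∈ n.divisorsAntidiagonal, ∑ q ∈ p.2.divisorsAntidiagonal, F p.1 q.1 q.2 =
    ∑ p ∈ n.divisorsAntidiagonal, ∑ q ∈ p.2.divisorsAntidiagonal, F q.1 p.1 q.2 := by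
  rw [← sum_anti_assoc, ← sum_anti_assoc (fun a b c => F b a c)]
  refine Finset.sum_congr rfl fun p _ => ?_
  conv_lhs => rw [← Nat.map_swap_divisorsAntidiagonal, Finset.sum_map]
  rfl

/-- Theorem 2, part 2: the composition rule
`⟨1,a(s)⟩⟨1,b(s)⟩ = ⟨1, a(s)(b(s)∘a(s))⟩` for Riordan–Dirichlet operators. -/
theorem dirichletComp_comp (A B : ℝ → ArithmeticFunction ℝ)
    (hA0 : A 0 = 1) (hAadd : ∀ x y : ℝ, A (x + y) = A x * A y)
    (hB0 : B 0 = 1) (hBadd : ∀ x y : ℝ, B (x + y) = B x * B y)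
    (f : ArithmeticFunction ℝ) :
    dirichletComp A (dirichletComp B f) =
      dirichletComp (fun φ => A φ * dirichletComp A (B φ)) f := by
  ext n
  rw [dirichletComp_apply_anti, dirichletComp_apply_anti]
  simp only [dirichletComp_apply_anti, Finset.sum_mul, ArithmeticFunction.mul_apply, Finset.mul_sum]
  have h1 : ∀ p ∈ n.divisorsAntidiagonal, ∀ q ∈ p.1.divisorsAntidiagonal,
      f q.1 * B (Real.log q.1) q.2 * A (Real.log p.1) p.2 =
      ∑ r ∈ p.2.divisorsAntidiagonal,
        f q.1 * (A (Real.log q.1) r.1 * (B (Real.log q.1) q.2 * A (Real.log q.2) r.2)) := by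
    intro p _ q hq
    obtain ⟨hq1, hq0⟩ := Nat.mem_divisorsAntidiagonal.1 hq
    have ha : q.1 ≠ 0 := by rintro h; simp [h] at hq1; omega
    have hb : q.2 ≠ 0 := by rintro h; simp [h] at hq1; omega
    rw [← hq1, Nat.cast_mul, Real.log_mul (by exact_mod_cast ha) (by exact_mod_cast hb), hAadd,
      ArithmeticFunction.mul_apply, Finset.mul_sum]
    exact Finset.sum_congr rfl fun r _ => by ring
  rw [Finset.sum_congr rfl fun p hp => Finset.sum_congr rfl (h1 p hp)]
  rw [sum_anti_assoc (fun a b c => ∑ r ∈ c.divisorsAntidiagonal,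
        f a * (A (Real.log a) r.1 * (B (Real.log a) b * A (Real.log b) r.2)))]
  refine Finset.sum_congr rfl fun p _ => ?_
  exact sum_anti_left_comm (fun b x y =>
    f p.1 * (A (Real.log p.1) x * (B (Real.log p.1) b * A (Real.log b) y))) p.2
end

section
/- Vandermonde-type identity for the factorization binomial coefficients: For every positive integer n and all real numbers φ, ψ: (φ + ψ)^{Ω(n)} = ∑_{d | n} (n choose d)_f · φ^{Ω(d)} · ψ^{Ω(n/d)}. (This expresses ε^{φ+ψ}(s) = ε^φ(s)ε^ψ(s) for the Dirichlet series ε(s) with [n^{-s}]ε^φ(s) = φ^{Ω(n)}/f(n).) -/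
open Finset ArithmeticFunction

/-- The factorization binomial coefficient
`(n choose d)_f = ∏_{p prime} C(ν_p(n), ν_p(d)) = f(n)/(f(d)·f(n/d))`,
where `f(n) = ∏_p (ν_p(n))!`. -/
def fChoose (n d : ℕ) : ℕ :=
  ∏ p ∈ n.primeFactors, Nat.choose (padicValNat p n) (padicValNat p d)

theorem fChoose_mul_aux {a b x y : ℕ} (ha : a ≠ 0) (hb : b ≠ 0) (hab : Nat.Coprime a b)
    (hx : x ∣ a) (hy : y ∣ b) : fChoose (a * b) (x * y) = fChoose a x * fChoose b y := by
  have hx0 : x ≠ 0 := ne_zero_of_dvd_ne_zero ha hx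
  have hy0 : y ≠ 0 := ne_zero_of_dvd_ne_zero hb hy
  unfold fChoose
  rw [Nat.primeFactors_mul ha hb, Finset.prod_union hab.disjoint_primeFactors]
  congr 1
  · refine Finset.prod_congr rfl fun p hp => ?_
    have hpp := Nat.prime_of_mem_primeFactors hp
    haveI : Fact p.Prime := ⟨hpp⟩
    have hpb : ¬ p ∣ b := fun h =>
      Nat.not_coprime_of_dvd_of_dvd hpp.one_lt (Nat.dvd_of_mem_primeFactors hp) h hab
    have hpy : ¬ p ∣ y := fun h => hpb (h.trans hy)
    rw [padicValNat.mul ha hb, padicValNat.mul hx0 hy0,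
      padicValNat.eq_zero_of_not_dvd hpb, padicValNat.eq_zero_of_not_dvd hpy, add_zero, add_zero]
  · refine Finset.prod_congr rfl fun p hp => ?_
    have hpp := Nat.prime_of_mem_primeFactors hp
    haveI : Fact p.Prime := ⟨hpp⟩
    have hpa : ¬ p ∣ a := fun h =>
      Nat.not_coprime_of_dvd_of_dvd hpp.one_lt h (Nat.dvd_of_mem_primeFactors hp) hab
    have hpx : ¬ p ∣ x := fun h => hpa (h.trans hx)
    rw [padicValNat.mul ha hb, padicValNat.mul hx0 hy0,
      padicValNat.eq_zero_of_not_dvd hpa, padicValNat.eq_zero_of_not_dvd hpx, zero_add, zero_add]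

/-- Vandermonde-type identity for the factorization binomial coefficients:
`(φ+ψ)^{Ω(n)} = ∑_{d ∣ n} (n choose d)_f · φ^{Ω(d)} · ψ^{Ω(n/d)}`. -/
theorem fChoose_vandermonde (n : ℕ) (hn : 0 < n) (φ ψ : ℝ) :
    (φ + ψ) ^ (cardFactors n) =
      ∑ d ∈ n.divisors,
        (fChoose n d : ℝ) * φ ^ (cardFactors d) * ψ ^ (cardFactors (n / d)) := by
  induction n using Nat.recOnPosPrimePosCoprime with
  | zero => exact absurd hn (lt_irrefl _)
  | one => simp [fChoose]
  | prime_pow p k hp hk =>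
    haveI : Fact p.Prime := ⟨hp⟩
    rw [Nat.sum_divisors_prime_pow hp, cardFactors_apply_prime_pow hp, add_pow]
    refine Finset.sum_congr rfl fun i hi => ?_
    have hik : i ≤ k := Nat.lt_succ_iff.mp (Finset.mem_range.mp hi)
    rw [Nat.pow_div hik hp.pos, cardFactors_apply_prime_pow hp, cardFactors_apply_prime_pow hp]
    unfold fChoose
    rw [Nat.primeFactors_prime_pow hk.ne' hp, Finset.prod_singleton, padicValNat.prime_pow,
      padicValNat.prime_pow]
    ring
  | coprime a b ha hb hab iha ihb =>
    have ha0 : a ≠ 0 := by omega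
    have hb0 : b ≠ 0 := by omega
    rw [cardFactors_mul ha0 hb0, pow_add, iha (by omega), ihb (by omega), Finset.sum_mul_sum,
      ← Finset.sum_product', Nat.divisors_mul, Finset.mul_def,
      Finset.sum_image hab.mul_injOn_divisors]
    refine Finset.sum_congr rfl fun q hq => ?_
    obtain ⟨x, y⟩ := q
    simp only [Finset.mem_product, Nat.mem_divisors] at hq
    obtain ⟨⟨hx, -⟩, ⟨hy, -⟩⟩ := hq
    have hx0 : x ≠ 0 := ne_zero_of_dvd_ne_zero ha0 hx
    have hy0 : y ≠ 0 := ne_zero_of_dvd_ne_zero hb0 hy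
    have h1 : a / x ≠ 0 := (Nat.div_pos (Nat.le_of_dvd (by omega) hx) (by omega)).ne'
    have h2 : b / y ≠ 0 := (Nat.div_pos (Nat.le_of_dvd (by omega) hy) (by omega)).ne'
    simp only
    rw [fChoose_mul_aux ha0 hb0 hab hx hy, Nat.mul_div_mul_comm hx hy, cardFactors_mul hx0 hy0,
      cardFactors_mul h1 h2]
    push_cast
    ring
end

section
/- Analog of Abel's generalized binomial formula: Define A(φ, n) := 1 if n = 1 and A(φ, n) := φ·(φ + log n)^{Ω(n) - 1} if n ≥ 2. Then for every positive integer n and all real numbers φ, β: A(φ + β, n) = ∑_{d | n} (n choose d)_f · A(φ, d) · A(β, n/d); that is, (φ+β)(φ+β+ln n)^{Ω(n)-1} = ∑_{d|n} (n choose d)_f · φ(φ+ln d)^{Ω(d)-1} · β(β+ln(n/d))^{Ω(n/d)-1} with the convention that the factor for the trivial divisor 1 equals 1. -/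
open Finset ArithmeticFunction

/-- The Abel-type factor `A(φ, n) = φ·(φ + ln n)^{Ω(n)-1}` for `n ≥ 2`,
with `A(φ, 1) = 1`. -/
noncomputable def abelFactor (φ : ℝ) (n : ℕ) : ℝ :=
  if n = 1 then 1 else φ * (φ + Real.log n) ^ (cardFactors n - 1)

/-- Finite differences kill low-degree powers. -/
lemma fin_diff {ι : Type*} [DecidableEq ι] (z : ι → ℝ) (S : Finset ι) :
    ∀ (k : ℕ) (x : ℝ), k < S.card →
      ∑ T ∈ S.powerset, (-1 : ℝ) ^ T.card * (x + ∑ i ∈ T, z i) ^ k = 0 := by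
  induction S using Finset.induction_on with
  | empty => intro k x h; simp at h
  | insert a S ha ih =>
    intro k x h
    rw [Finset.card_insert_of_notMem ha] at h
    rw [Finset.sum_powerset_insert ha]
    have key : ∀ T ∈ S.powerset,
        (-1 : ℝ) ^ (insert a T).card * (x + ∑ i ∈ insert a T, z i) ^ k =
        -(∑ j ∈ Finset.range k, (z a ^ (k - j) * (k.choose j : ℝ)) *
          ((-1 : ℝ) ^ T.card * (x + ∑ i ∈ T, z i) ^ j))
        - (-1 : ℝ) ^ T.card * (x + ∑ i ∈ T, z i) ^ k := by
      intro T hT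
      have haT : a ∉ T := fun h' => ha (Finset.mem_powerset.1 hT h')
      rw [Finset.card_insert_of_notMem haT, Finset.sum_insert haT,
        show x + (z a + ∑ i ∈ T, z i) = (x + ∑ i ∈ T, z i) + z a by ring,
        add_pow, Finset.sum_range_succ]
      simp only [Nat.choose_self, Nat.sub_self, pow_zero, pow_succ]
      rw [mul_add, Finset.mul_sum, ← Finset.sum_neg_distrib]
      rw [sub_eq_add_neg]
      congr 1
      · apply Finset.sum_congr rfl
        intro j _
        ring
      · simp
    rw [Finset.sum_congr rfl key, Finset.sum_sub_distrib, Finset.sum_neg_distrib,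
      Finset.sum_comm]
    have : ∑ j ∈ Finset.range k, ∑ T ∈ S.powerset, (z a ^ (k - j) * (k.choose j : ℝ)) *
          ((-1 : ℝ) ^ T.card * (x + ∑ i ∈ T, z i) ^ j) = 0 := by
      apply Finset.sum_eq_zero
      intro j hj
      rw [← Finset.mul_sum, ih j x (by have := Finset.mem_range.1 hj; omega), mul_zero]
    rw [this]; ring

/-- Abel factor of a weighted finite set. -/
noncomputable def setAbel {ι : Type*} (z : ι → ℝ) (x : ℝ) (T : Finset ι) : ℝ :=
  if T.card = 0 then 1 else x * (x + ∑ i ∈ T, z i) ^ (T.card - 1)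

/-- Removing an element inside a power. -/
lemma erase_pow {ι : Type*} [DecidableEq ι] (z : ι → ℝ) (S T : Finset ι) (y : ℝ) (i : ι)
    (hi : i ∈ S \ T) :
    (y + z i + ∑ j ∈ S.erase i \ T, z j) ^ (S.erase i \ T).card =
      (y + ∑ j ∈ S \ T, z j) ^ ((S \ T).card - 1) := by
  have h : S.erase i \ T = (S \ T).erase i := by
    ext j; simp only [Finset.mem_sdiff, Finset.mem_erase]; tauto
  rw [h, Finset.card_erase_of_mem hi, ← Finset.add_sum_erase _ z hi, add_assoc]

/-- Exchange of summation. -/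
lemma sum_swap {ι : Type*} [DecidableEq ι] (S : Finset ι) (f : Finset ι → ι → ℝ) :
    ∑ T ∈ S.powerset, ∑ i ∈ S \ T, f T i = ∑ i ∈ S, ∑ T ∈ (S.erase i).powerset, f T i := by
  apply Finset.sum_comm'
  intro T i
  simp only [Finset.mem_powerset, Finset.mem_sdiff, Finset.subset_erase]
  tauto

/-- The mixed Hurwitz identity. -/
lemma hurwitz_mixed {ι : Type*} [DecidableEq ι] (z : ι → ℝ) (x : ℝ) (S : Finset ι) :
    ∀ y : ℝ, ∑ T ∈ S.powerset, setAbel z x T * (y + ∑ i ∈ S \ T, z i) ^ (S \ T).card =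
      (x + y + ∑ i ∈ S, z i) ^ S.card := by
  induction S using Finset.strongInduction with
  | H S ih =>
    rcases Finset.eq_empty_or_nonempty S with rfl | hS
    · intro y; simp [setAbel]
    have hcard : 0 < S.card := Finset.card_pos.2 hS
    set F : ℝ → ℝ := fun y => ∑ T ∈ S.powerset,
      setAbel z x T * (y + ∑ i ∈ S \ T, z i) ^ (S \ T).card
        - (x + y + ∑ i ∈ S, z i) ^ S.card with hF
    have hd : ∀ y, HasDerivAt F 0 y := by
      intro y
      have h1 : HasDerivAt F (∑ T ∈ S.powerset,
          setAbel z x T * (((S \ T).card : ℝ) * (y + ∑ i ∈ S \ T, z i) ^ ((S \ T).card - 1) * 1)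
          - (S.card : ℝ) * (x + y + ∑ i ∈ S, z i) ^ (S.card - 1) * 1) y := by
        apply HasDerivAt.sub
        · apply HasDerivAt.fun_sum
          intro T _
          exact (((hasDerivAt_id y).add_const _).pow _).const_mul _
        · exact (((hasDerivAt_id y).const_add x).add_const _).pow _
      convert h1 using 1
      have h2 : ∀ T ∈ S.powerset,
          setAbel z x T * (((S \ T).card : ℝ) * (y + ∑ i ∈ S \ T, z i) ^ ((S \ T).card - 1) * 1)
          = ∑ i ∈ S \ T, setAbel z x T *
            (y + z i + ∑ j ∈ S.erase i \ T, z j) ^ (S.erase i \ T).card := by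
        intro T _
        have h2' : ∀ i ∈ S \ T, setAbel z x T *
            (y + z i + ∑ j ∈ S.erase i \ T, z j) ^ (S.erase i \ T).card =
            setAbel z x T * (y + ∑ j ∈ S \ T, z j) ^ ((S \ T).card - 1) :=
          fun i hi => by rw [erase_pow z S T y i hi]
        rw [Finset.sum_congr rfl h2', Finset.sum_const, nsmul_eq_mul]
        ring
      rw [Finset.sum_congr rfl h2, sum_swap]
      have h3 : ∀ i ∈ S, ∑ T ∈ (S.erase i).powerset, setAbel z x T *
            (y + z i + ∑ j ∈ S.erase i \ T, z j) ^ (S.erase i \ T).card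
            = (x + y + ∑ i ∈ S, z i) ^ (S.card - 1) := by
        intro i hi
        rw [ih _ (Finset.erase_ssubset hi), Finset.card_erase_of_mem hi,
          ← Finset.add_sum_erase S z hi]
        ring
      rw [Finset.sum_congr rfl h3, Finset.sum_const, nsmul_eq_mul]
      ring
    have hconst : ∀ y, F y = F (-x - ∑ i ∈ S, z i) := fun y =>
      is_const_of_deriv_eq_zero (fun y => (hd y).differentiableAt) (fun y => (hd y).deriv) _ _
    have hz : F (-x - ∑ i ∈ S, z i) = 0 := by
      have h4 : ∀ T ∈ S.powerset, setAbel z x T *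
          (-x - ∑ i ∈ S, z i + ∑ i ∈ S \ T, z i) ^ (S \ T).card =
          ((-1) ^ S.card * x) * ((-1 : ℝ) ^ T.card * (x + ∑ i ∈ T, z i) ^ (S.card - 1)) := by
        intro T hT
        have hT' := Finset.mem_powerset.1 hT
        have hle := Finset.card_le_card hT'
        have hsum := Finset.sum_sdiff (f := z) hT'
        rw [show -x - ∑ i ∈ S, z i + ∑ i ∈ S \ T, z i = (-1) * (x + ∑ i ∈ T, z i) by
          rw [← hsum]; ring, mul_pow, Finset.card_sdiff_of_subset hT']
        have hs : (-1 : ℝ) ^ (S.card - T.card) = (-1) ^ S.card * (-1) ^ T.card := by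
          obtain ⟨m, hm⟩ := Nat.exists_eq_add_of_le hle
          rw [hm, Nat.add_sub_cancel_left, pow_add, mul_right_comm, ← mul_pow]; simp
        rw [hs]
        unfold setAbel
        split_ifs with h0
        · have : T = ∅ := Finset.card_eq_zero.1 h0
          subst this
          have : x ^ S.card = x * x ^ (S.card - 1) := by
            rw [← pow_succ']; congr 1; omega
          simp only [Finset.card_empty, Finset.sum_empty, add_zero, Nat.sub_zero, this]
          ring
        · rw [show S.card - 1 = (T.card - 1) + (S.card - T.card) by omega, pow_add]
          ring
      simp only [hF]
      rw [Finset.sum_congr rfl h4, ← Finset.mul_sum, fin_diff z S _ _ (by omega),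
        show x + (-x - ∑ i ∈ S, z i) + ∑ i ∈ S, z i = 0 by ring, zero_pow (by omega)]
      simp
    intro y
    have := (hconst y).trans hz
    simp only [hF] at this
    linarith

/-- The Hurwitz identity. -/
lemma hurwitz {ι : Type*} [DecidableEq ι] (z : ι → ℝ) (x y : ℝ) (S : Finset ι) :
    setAbel z (x + y) S = ∑ T ∈ S.powerset, setAbel z x T * setAbel z y (S \ T) := by
  rcases Finset.eq_empty_or_nonempty S with rfl | hS
  · simp [setAbel]
  have hcard : 0 < S.card := Finset.card_pos.2 hS
  have h1 : ∀ T ∈ S.powerset, setAbel z x T * setAbel z y (S \ T) =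
      setAbel z x T * (y + ∑ i ∈ S \ T, z i) ^ (S \ T).card -
      ∑ i ∈ S \ T, z i * (setAbel z x T *
            (y + z i + ∑ j ∈ S.erase i \ T, z j) ^ (S.erase i \ T).card) := by
    intro T _
    have h2' : ∀ i ∈ S \ T, z i * (setAbel z x T *
        (y + z i + ∑ j ∈ S.erase i \ T, z j) ^ (S.erase i \ T).card) =
        z i * (setAbel z x T * (y + ∑ j ∈ S \ T, z j) ^ ((S \ T).card - 1)) :=
      fun i hi => by rw [erase_pow z S T y i hi]
    rw [Finset.sum_congr rfl h2', ← Finset.sum_mul]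
    rw [setAbel.eq_def z y]
    split_ifs with h0
    · rw [Finset.card_eq_zero.1 h0]; simp
    · obtain ⟨m, hm⟩ := Nat.exists_eq_succ_of_ne_zero h0
      rw [hm, Nat.succ_sub_one, pow_succ]
      ring
  rw [Finset.sum_congr rfl h1, Finset.sum_sub_distrib, hurwitz_mixed, sum_swap]
  have h3 : ∀ i ∈ S, ∑ T ∈ (S.erase i).powerset, z i * (setAbel z x T *
        (y + z i + ∑ j ∈ S.erase i \ T, z j) ^ (S.erase i \ T).card)
        = z i * (x + y + ∑ i ∈ S, z i) ^ (S.card - 1) := by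
    intro i hi
    rw [← Finset.mul_sum, hurwitz_mixed, Finset.card_erase_of_mem hi,
      ← Finset.add_sum_erase S z hi]
    ring
  rw [Finset.sum_congr rfl h3, ← Finset.sum_mul]
  unfold setAbel
  rw [if_neg (by omega)]
  obtain ⟨m, hm⟩ := Nat.exists_eq_succ_of_ne_zero hcard.ne'
  rw [hm, Nat.succ_sub_one, pow_succ]
  ring

/-- Binomial coefficient relative to a fixed set of primes. -/
def relChoose (P : Finset ℕ) (m d : ℕ) : ℕ :=
  ∏ p ∈ P, Nat.choose (m.factorization p) (d.factorization p)

lemma relChoose_mul (P : Finset ℕ) (p m d : ℕ) (hp : p.Prime) (hpP : p ∈ P) (hm : m ≠ 0)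
    (hd : d ≠ 0) :
    relChoose P (p * m) d = relChoose P m d + if p ∣ d then relChoose P m (d / p) else 0 := by
  unfold relChoose
  have e1 : (p * m).factorization = Finsupp.single p 1 + m.factorization := by
    rw [Nat.factorization_mul hp.ne_zero hm, hp.factorization]
  rw [← Finset.mul_prod_erase P _ hpP, ← Finset.mul_prod_erase P _ hpP,
    ← Finset.mul_prod_erase P _ hpP]
  have h1 : ∏ q ∈ P.erase p, Nat.choose ((p * m).factorization q) (d.factorization q)
      = ∏ q ∈ P.erase p, Nat.choose (m.factorization q) (d.factorization q) := by
    apply Finset.prod_congr rfl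
    intro q hq
    rw [e1]
    simp [(Finset.ne_of_mem_erase hq)]
  rw [h1]
  have e1p : (p * m).factorization p = m.factorization p + 1 := by
    rw [e1]; simp [add_comm]
  rw [e1p]
  split_ifs with hpd
  · obtain ⟨e, rfl⟩ := hpd
    have he : e ≠ 0 := by rintro rfl; simp at hd
    have e2 : (p * e).factorization = Finsupp.single p 1 + e.factorization := by
      rw [Nat.factorization_mul hp.ne_zero he, hp.factorization]
    rw [Nat.mul_div_cancel_left _ hp.pos]
    have h2 : ∏ q ∈ P.erase p, Nat.choose (m.factorization q) ((p * e).factorization q)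
      = ∏ q ∈ P.erase p, Nat.choose (m.factorization q) (e.factorization q) := by
      apply Finset.prod_congr rfl
      intro q hq
      rw [e2]
      simp [(Finset.ne_of_mem_erase hq)]
    have e2p : (p * e).factorization p = e.factorization p + 1 := by
      rw [e2]; simp [add_comm]
    rw [h2, e2p, Nat.choose_succ_succ']
    ring
  · rw [Nat.factorization_eq_zero_of_not_dvd hpd]
    simp

lemma bridge {ι : Type*} [DecidableEq ι] (q : ι → ℕ) (hq : ∀ i, (q i).Prime) (N : ℕ)
    (hN : N ≠ 0) (S : Finset ι) : ∀ (g : ℕ → ℝ), ∏ i ∈ S, q i ∣ N →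
    ∑ T ∈ S.powerset, g (∏ i ∈ T, q i) =
      ∑ d ∈ N.divisors, (relChoose N.primeFactors (∏ i ∈ S, q i) d : ℝ) * g d := by
  induction S using Finset.induction_on with
  | empty =>
    intro g _
    symm
    rw [Finset.sum_eq_single 1]
    · simp [relChoose]
    · intro d hd hd1
      obtain ⟨p, hp, hpd⟩ := Nat.exists_prime_and_dvd hd1
      have hdN := Nat.dvd_of_mem_divisors hd
      have : relChoose N.primeFactors (∏ i ∈ (∅ : Finset ι), q i) d = 0 := by
        unfold relChoose
        apply Finset.prod_eq_zero (i := p)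
        · exact Nat.mem_primeFactors.2 ⟨hp, hpd.trans hdN, hN⟩
        · simp only [Finset.prod_empty, Nat.factorization_one, Finsupp.coe_zero, Pi.zero_apply]
          apply Nat.choose_eq_zero_of_lt
          exact hp.factorization_pos_of_dvd (ne_zero_of_dvd_ne_zero hN hdN) hpd
      rw [this]; simp
    · intro h; simp [hN] at h
  | insert a S ha ih =>
    intro g hdvd
    rw [Finset.prod_insert ha] at hdvd ⊢
    set m := ∏ i ∈ S, q i with hm
    have hmN : m ∣ N := (Dvd.intro_left _ rfl).trans hdvd
    have hm0 : m ≠ 0 := ne_zero_of_dvd_ne_zero hN hmN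
    have hpN : q a ∣ N := (Dvd.intro _ rfl).trans hdvd
    have haP : q a ∈ N.primeFactors := Nat.mem_primeFactors.2 ⟨hq a, hpN, hN⟩
    rw [Finset.sum_powerset_insert ha]
    have h1 : ∑ T ∈ S.powerset, g (∏ i ∈ insert a T, q i) =
        ∑ T ∈ S.powerset, (fun d => g (q a * d)) (∏ i ∈ T, q i) := by
      apply Finset.sum_congr rfl
      intro T hT
      rw [Finset.prod_insert (fun h' => ha (Finset.mem_powerset.1 hT h'))]
    rw [h1, ih g hmN, ih (fun d => g (q a * d)) hmN]
    have h2 : ∀ d ∈ N.divisors, (relChoose N.primeFactors (q a * m) d : ℝ) * g d =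
        (relChoose N.primeFactors m d : ℝ) * g d +
        if q a ∣ d then (relChoose N.primeFactors m (d / q a) : ℝ) * g d else 0 := by
      intro d hd
      rw [relChoose_mul _ _ _ _ (hq a) haP hm0
        (ne_zero_of_dvd_ne_zero hN (Nat.dvd_of_mem_divisors hd))]
      split_ifs <;> push_cast <;> ring
    rw [Finset.sum_congr rfl h2, Finset.sum_add_distrib]
    congr 1
    rw [← Finset.sum_filter]
    symm
    apply Finset.sum_bij_ne_zero (fun d _ _ => d / q a)
    · intro d hd _
      rw [Finset.mem_filter] at hd
      exact Nat.mem_divisors.2 ⟨(Nat.div_dvd_of_dvd hd.2).trans (Nat.dvd_of_mem_divisors hd.1), hN⟩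
    · intro d hd _ e he _ hde
      rw [Finset.mem_filter] at hd he
      rw [← Nat.mul_div_cancel' hd.2, hde, Nat.mul_div_cancel' he.2]
    · intro d hd hne
      have hd0 : d ≠ 0 := ne_zero_of_dvd_ne_zero hN (Nat.dvd_of_mem_divisors hd)
      have hdm : d ∣ m := by
        rw [← Nat.factorization_le_iff_dvd hd0 hm0]
        intro p
        by_contra hlt
        push Not at hlt
        apply hne
        have : relChoose N.primeFactors m d = 0 := by
          unfold relChoose
          apply Finset.prod_eq_zero (i := p)
          · have : d.factorization p ≠ 0 := by omega
            have hpd : p ∈ d.primeFactors := by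
              rw [← Nat.support_factorization]; exact Finsupp.mem_support_iff.2 this
            exact Nat.primeFactors_mono (Nat.dvd_of_mem_divisors hd) hN hpd
          · exact Nat.choose_eq_zero_of_lt hlt
        rw [this]; simp
      refine ⟨q a * d, ?_, ?_, ?_⟩
      · rw [Finset.mem_filter, Nat.mem_divisors]
        exact ⟨⟨(Nat.mul_dvd_mul_left _ hdm).trans hdvd, hN⟩, Dvd.intro _ rfl⟩
      · rw [Nat.mul_div_cancel_left _ (hq a).pos]; exact hne
      · exact Nat.mul_div_cancel_left _ (hq a).pos
    · intro d hd _
      rw [Finset.mem_filter] at hd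
      simp only [Nat.mul_div_cancel' hd.2]

lemma setAbel_eq {ι : Type*} [DecidableEq ι] (q : ι → ℕ) (hq : ∀ i, (q i).Prime) (x : ℝ)
    (T : Finset ι) :
    abelFactor x (∏ i ∈ T, q i) = setAbel (fun i => Real.log (q i)) x T := by
  have h0 : ∀ T : Finset ι, ∏ i ∈ T, q i ≠ 0 := fun T =>
    Finset.prod_ne_zero_iff.2 fun i _ => (hq i).ne_zero
  have hc : ∀ T : Finset ι, cardFactors (∏ i ∈ T, q i) = T.card := by
    intro T
    induction T using Finset.induction_on with
    | empty => simp
    | insert a T ha ih =>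
      rw [Finset.prod_insert ha, cardFactors_mul (hq a).ne_zero (h0 T), ih,
        Finset.card_insert_of_notMem ha, cardFactors_apply_prime (hq a), add_comm]
  have h1 : (∏ i ∈ T, q i = 1) ↔ T.card = 0 := by
    rw [← hc T, cardFactors_eq_zero_iff_eq_zero_or_one]
    simp [h0 T]
  unfold abelFactor setAbel
  simp only [h1, hc]
  rw [Nat.cast_prod, Real.log_prod (fun i _ => by exact_mod_cast (hq i).ne_zero)]

/-- Analog of Abel's generalized binomial formula:
`(φ+β)(φ+β+ln n)^{Ω(n)-1} = ∑_{d∣n} (n choose d)_f · φ(φ+ln d)^{Ω(d)-1} ·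
β(β+ln(n/d))^{Ω(n/d)-1}`. -/
theorem abel_generalized_binomial (n : ℕ) (hn : 0 < n) (φ β : ℝ) :
    abelFactor (φ + β) n =
      ∑ d ∈ n.divisors, (fChoose n d : ℝ) * abelFactor φ d * abelFactor β (n / d) := by
  obtain ⟨q, hq, hprod⟩ : ∃ q : Fin n.primeFactorsList.length → ℕ,
      (∀ i, (q i).Prime) ∧ ∏ i ∈ Finset.univ, q i = n := by
    refine ⟨fun i => n.primeFactorsList.get i, fun i =>
      Nat.prime_of_mem_primeFactorsList (List.get_mem _ _), ?_⟩
    rw [← List.prod_ofFn, List.ofFn_get]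
    exact Nat.prod_primeFactorsList hn.ne'
  have hb := bridge q hq n hn.ne' Finset.univ (fun d => abelFactor φ d * abelFactor β (n / d))
    (by rw [hprod])
  rw [hprod] at hb
  have hh := hurwitz (fun i => Real.log (q i)) φ β Finset.univ
  rw [← setAbel_eq q hq, hprod] at hh
  rw [hh]
  have e1 : ∀ d ∈ n.divisors, (fChoose n d : ℝ) * abelFactor φ d * abelFactor β (n / d) =
      (relChoose n.primeFactors n d : ℝ) * (abelFactor φ d * abelFactor β (n / d)) := by
    intro d _
    have : fChoose n d = relChoose n.primeFactors n d := by
      unfold fChoose relChoose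
      apply Finset.prod_congr rfl
      intro p hp
      have hp' := Nat.prime_of_mem_primeFactors hp
      rw [Nat.factorization_def _ hp', Nat.factorization_def _ hp']
    rw [this, mul_assoc]
  rw [Finset.sum_congr rfl e1, ← hb]
  apply Finset.sum_congr rfl
  intro T hT
  rw [← setAbel_eq q hq, ← setAbel_eq q hq]
  congr 2
  have h3 := Finset.prod_sdiff (f := q) (Finset.subset_univ T)
  rw [hprod] at h3
  exact (Nat.div_eq_of_eq_mul_left (Finset.prod_pos fun i _ => (hq i).pos) h3.symm).symm
end

section
/- Third Abel-type identity: For every integer n ≥ 2 and every real number φ: φ·(φ + log n)^{Ω(n) - 1} = φ^{Ω(n)} + ∑_{d | n, d ≠ n} (n choose d)_f · φ^{Ω(d)} · (log d) · (log n)^{Ω(n/d) - 1}. (The d = n summand of the paper's formula ∑_{d|n} (n choose d)_f φ^{Ω(d)} ln d (ln n)^{Ω(n/d)-1} is interpreted as φ^{Ω(n)}; for proper divisors d the exponent Ω(n/d)-1 is a natural number, and the d = 1 summand vanishes since log 1 = 0.) -/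
open Finset ArithmeticFunction

namespace AbelThird

/-- product of binomials over a fixed finite set of primes -/
def F (S : Finset ℕ) (n d : ℕ) : ℕ :=
  ∏ q ∈ S, Nat.choose (n.factorization q) (d.factorization q)

lemma F_eq_zero {S : Finset ℕ} {p n d : ℕ} (hp : p.Prime) (hpS : p ∈ S) (hn : n ≠ 0)
    (hd : d ∣ p * n) (hdn : ¬ d ∣ n) : F S n d = 0 := by
  apply Finset.prod_eq_zero hpS
  apply Nat.choose_eq_zero_of_lt
  by_contra hcon
  push Not at hcon
  apply hdn
  have hpn : p * n ≠ 0 := mul_ne_zero hp.ne_zero hn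
  have hd0 : d ≠ 0 := ne_zero_of_dvd_ne_zero hpn hd
  rw [← Nat.factorization_le_iff_dvd hd0 hn]
  intro q
  have h := (Nat.factorization_le_iff_dvd hd0 hpn).2 hd q
  rw [Nat.factorization_mul hp.ne_zero hn, hp.factorization] at h
  by_cases hq : q = p
  · subst hq; exact hcon
  · simpa [Finsupp.single_apply, Ne.symm hq] using h

lemma F_self_mul {S : Finset ℕ} {p n d : ℕ} (hp : p.Prime) (hpS : p ∈ S) (hn : n ≠ 0)
    (hd : d ≠ 0) : F S (p * n) (p * d) = F S n (p * d) + F S n d := by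
  unfold F
  rw [← Finset.mul_prod_erase S _ hpS, ← Finset.mul_prod_erase S _ hpS,
    ← Finset.mul_prod_erase S _ hpS]
  have h1 : ∀ m, m ≠ 0 → (p * m).factorization p = m.factorization p + 1 := by
    intro m hm
    rw [Nat.factorization_mul hp.ne_zero hm, hp.factorization]
    simp [add_comm]
  have h2 : ∀ m, m ≠ 0 → ∀ q ∈ S.erase p, (p * m).factorization q = m.factorization q := by
    intro m hm q hq
    have : p ≠ q := (Finset.ne_of_mem_erase hq).symm
    rw [Nat.factorization_mul hp.ne_zero hm, hp.factorization]
    simp [this]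
  have e1 : ∏ q ∈ S.erase p, ((p * n).factorization q).choose ((p * d).factorization q)
      = ∏ q ∈ S.erase p, (n.factorization q).choose (d.factorization q) :=
    Finset.prod_congr rfl fun q hq => by rw [h2 n hn q hq, h2 d hd q hq]
  have e2 : ∏ q ∈ S.erase p, (n.factorization q).choose ((p * d).factorization q)
      = ∏ q ∈ S.erase p, (n.factorization q).choose (d.factorization q) :=
    Finset.prod_congr rfl fun q hq => by rw [h2 d hd q hq]
  rw [e1, e2, h1 n hn, h1 d hd, Nat.choose_succ_succ]
  ring

lemma F_not_dvd {S : Finset ℕ} {p n d : ℕ} (hp : p.Prime) (hn : n ≠ 0)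
    (hd : ¬ p ∣ d) : F S (p * n) d = F S n d := by
  unfold F
  refine Finset.prod_congr rfl fun q _ => ?_
  by_cases hq : q = p
  · subst hq
    simp [Nat.factorization_eq_zero_of_not_dvd hd]
  · rw [Nat.factorization_mul hp.ne_zero hn, hp.factorization]
    simp [Finsupp.single_apply, Ne.symm hq]

lemma sum_rec {S : Finset ℕ} {p n : ℕ} (hp : p.Prime) (hpS : p ∈ S) (hn : n ≠ 0)
    (g : ℕ → ℝ) : ∑ d ∈ (p * n).divisors, (F S (p * n) d : ℝ) * g d =
      ∑ d ∈ n.divisors, (F S n d : ℝ) * (g d + g (p * d)) := by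
  have hpn : p * n ≠ 0 := mul_ne_zero hp.ne_zero hn
  have key : ∀ d ∈ (p * n).divisors, (F S (p * n) d : ℝ) * g d =
      (F S n d : ℝ) * g d + if p ∣ d then (F S n (d / p) : ℝ) * g d else 0 := by
    intro d hd
    have hd0 : d ≠ 0 := (Nat.pos_of_mem_divisors hd).ne'
    split_ifs with h
    · obtain ⟨e, rfl⟩ := h
      have he : e ≠ 0 := right_ne_zero_of_mul hd0
      rw [F_self_mul hp hpS hn he, Nat.mul_div_cancel_left _ hp.pos]
      push_cast; ring
    · rw [F_not_dvd hp hn h]; ring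
  rw [Finset.sum_congr rfl key, Finset.sum_add_distrib]
  simp_rw [mul_add]
  rw [Finset.sum_add_distrib]
  congr 1
  · symm
    apply Finset.sum_subset (Nat.divisors_subset_of_dvd hpn (Dvd.intro_left p rfl))
    intro d hd hdn
    rw [F_eq_zero hp hpS hn (Nat.dvd_of_mem_divisors hd) (fun h => hdn (by simp [h, hn]))]
    simp
  · rw [← Finset.sum_filter]
    symm
    refine Finset.sum_bij' (fun d _ => p * d) (fun d _ => d / p) ?_ ?_ ?_ ?_ ?_
    · intro d hd
      simp only [Finset.mem_filter, Nat.mem_divisors]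
      exact ⟨⟨mul_dvd_mul_left p (Nat.dvd_of_mem_divisors hd), hpn⟩, dvd_mul_right _ _⟩
    · intro d hd
      simp only [Finset.mem_filter, Nat.mem_divisors] at hd
      obtain ⟨⟨h, _⟩, e, rfl⟩ := hd
      rw [Nat.mul_div_cancel_left _ hp.pos]
      exact Nat.mem_divisors.2 ⟨Nat.dvd_of_mul_dvd_mul_left hp.pos h, hn⟩
    · intro d _; exact Nat.mul_div_cancel_left _ hp.pos
    · intro d hd
      exact Nat.mul_div_cancel' (Finset.mem_filter.1 hd).2
    · intro d _; simp only [Nat.mul_div_cancel_left _ hp.pos]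

lemma card_mul {p d : ℕ} (hp : p.Prime) (hd : d ≠ 0) :
    cardFactors (p * d) = cardFactors d + 1 := by
  rw [cardFactors_mul hp.ne_zero hd, cardFactors_apply_prime hp, add_comm]

lemma card_le {n d : ℕ} (hn : n ≠ 0) (hd : d ∣ n) : cardFactors d ≤ cardFactors n := by
  obtain ⟨e, rfl⟩ := hd
  rw [cardFactors_mul (left_ne_zero_of_mul hn) (right_ne_zero_of_mul hn)]
  omega

lemma sumA (S : Finset ℕ) (x y : ℝ) (n : ℕ) : n ≠ 0 → n.primeFactors ⊆ S →
    ∑ d ∈ n.divisors, (F S n d : ℝ) * (x ^ cardFactors d * y ^ (cardFactors n - cardFactors d))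
      = (x + y) ^ cardFactors n := by
  induction n using induction_on_primes with
  | zero => simp
  | one => simp [F]
  | prime_mul p a hp ih =>
    intro h0 hS
    have ha : a ≠ 0 := right_ne_zero_of_mul h0
    have hpS : p ∈ S := hS (by simp [hp, ha, hp.ne_zero])
    have haS : a.primeFactors ⊆ S :=
      (Nat.primeFactors_mono (Dvd.intro_left p rfl) h0).trans hS
    rw [sum_rec hp hpS ha, card_mul hp ha, pow_succ, ← ih ha haS, Finset.sum_mul]
    refine Finset.sum_congr rfl fun d hd => ?_
    have hd0 : d ≠ 0 := (Nat.pos_of_mem_divisors hd).ne'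
    have hle := card_le ha (Nat.dvd_of_mem_divisors hd)
    rw [card_mul hp hd0, Nat.add_sub_add_right, Nat.sub_add_comm hle]
    ring

lemma sumB (S : Finset ℕ) (x y : ℝ) (n : ℕ) : n ≠ 0 → n.primeFactors ⊆ S →
    (x + y) * ∑ d ∈ n.divisors, (F S n d : ℝ) *
      (x ^ cardFactors d * y ^ (cardFactors n - cardFactors d) * Real.log d)
      = x * Real.log n * (x + y) ^ cardFactors n ∧
    (n ≠ 1 → ∑ d ∈ n.divisors, (F S n d : ℝ) *
      (x ^ cardFactors d * y ^ (cardFactors n - cardFactors d) * Real.log d)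
      = x * Real.log n * (x + y) ^ (cardFactors n - 1)) := by
  induction n using induction_on_primes with
  | zero => simp
  | one => simp [F]
  | prime_mul p a hp ih =>
    intro h0 hS
    have ha : a ≠ 0 := right_ne_zero_of_mul h0
    have hpS : p ∈ S := hS (by simp [hp, ha, hp.ne_zero])
    have haS : a.primeFactors ⊆ S :=
      (Nat.primeFactors_mono (Dvd.intro_left p rfl) h0).trans hS
    have hmain : ∑ d ∈ (p * a).divisors, (F S (p * a) d : ℝ) *
      (x ^ cardFactors d * y ^ (cardFactors (p * a) - cardFactors d) * Real.log d)
      = x * Real.log (p * a : ℕ) * (x + y) ^ (cardFactors (p * a) - 1) := by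
      have hlog : ∀ d : ℕ, d ≠ 0 → Real.log (p * d : ℕ) = Real.log p + Real.log d := by
        intro d hd
        rw [Nat.cast_mul, Real.log_mul (by exact_mod_cast hp.ne_zero) (by exact_mod_cast hd)]
      rw [sum_rec hp hpS ha, card_mul hp ha, Nat.add_sub_cancel, hlog a ha]
      have hA := sumA S x y a ha haS
      have hB := (ih ha haS).1
      have : x * (Real.log p + Real.log a) * (x + y) ^ cardFactors a =
        x * Real.log p * (x + y) ^ cardFactors a + x * Real.log a * (x + y) ^ cardFactors a := by
        ring
      rw [this, ← hB, ← hA, Finset.mul_sum, Finset.mul_sum, ← Finset.sum_add_distrib]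
      refine Finset.sum_congr rfl fun d hd => ?_
      have hd0 : d ≠ 0 := (Nat.pos_of_mem_divisors hd).ne'
      have hle := card_le ha (Nat.dvd_of_mem_divisors hd)
      rw [card_mul hp hd0, Nat.add_sub_add_right, Nat.sub_add_comm hle, hlog d hd0]
      ring
    refine ⟨?_, fun _ => hmain⟩
    rw [hmain, card_mul hp ha, Nat.add_sub_cancel]
    ring

lemma fChoose_eq (n d : ℕ) : fChoose n d = F n.primeFactors n d := by
  unfold fChoose F
  refine Finset.prod_congr rfl fun q hq => ?_
  rw [Nat.factorization_def _ (Nat.prime_of_mem_primeFactors hq),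
    Nat.factorization_def _ (Nat.prime_of_mem_primeFactors hq)]

end AbelThird

/-- Third Abel-type identity:
`φ(φ+ln n)^{Ω(n)-1} = φ^{Ω(n)} + ∑_{d∣n, d≠n} (n choose d)_f · φ^{Ω(d)} ·
ln d · (ln n)^{Ω(n/d)-1}`, where the `d = n` summand of the paper's formula is
interpreted as `φ^{Ω(n)}`. -/
theorem abel_third_identity (n : ℕ) (hn : 2 ≤ n) (φ : ℝ) :
    φ * (φ + Real.log n) ^ (cardFactors n - 1) =
      φ ^ (cardFactors n) +
        ∑ d ∈ n.divisors.erase n,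
          (fChoose n d : ℝ) * φ ^ (cardFactors d) * Real.log d *
            (Real.log n) ^ (cardFactors (n / d) - 1) := by
  have hn0 : n ≠ 0 := by omega
  have hB := (AbelThird.sumB n.primeFactors φ (Real.log n) n hn0 subset_rfl).2 (by omega)
  have hL : Real.log n ≠ 0 := (Real.log_pos (by exact_mod_cast hn)).ne'
  have hpos : 1 ≤ cardFactors n := by
    by_contra h
    have h0 : cardFactors n = 0 := by omega
    rcases cardFactors_eq_zero_iff_eq_zero_or_one.1 h0 with h | h <;> omega
  apply mul_left_cancel₀ hL
  rw [← Finset.add_sum_erase _ _ (Nat.mem_divisors_self n hn0)] at hB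
  have hself : AbelThird.F n.primeFactors n n = 1 := by simp [AbelThird.F]
  rw [hself, Nat.sub_self] at hB
  have hS : Real.log n * ∑ d ∈ n.divisors.erase n,
          (fChoose n d : ℝ) * φ ^ (cardFactors d) * Real.log d *
            (Real.log n) ^ (cardFactors (n / d) - 1) =
      ∑ d ∈ n.divisors.erase n, (AbelThird.F n.primeFactors n d : ℝ) *
      (φ ^ cardFactors d * Real.log n ^ (cardFactors n - cardFactors d) * Real.log d) := by
    rw [Finset.mul_sum]
    refine Finset.sum_congr rfl fun d hd => ?_
    rw [AbelThird.fChoose_eq]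
    obtain ⟨hne, hd⟩ := Finset.mem_erase.1 hd
    obtain ⟨e, he⟩ := Nat.dvd_of_mem_divisors hd
    have hd0 : d ≠ 0 := (Nat.pos_of_mem_divisors hd).ne'
    have he0 : e ≠ 0 := by rintro rfl; simp at he; omega
    have he1 : e ≠ 1 := by rintro rfl; simp at he; omega
    have hde : n / d = e := by rw [he]; exact Nat.mul_div_cancel_left _ (Nat.pos_of_ne_zero hd0)
    have hc : cardFactors n = cardFactors d + cardFactors e := by
      rw [he, cardFactors_mul hd0 he0]
    have hepos : cardFactors e ≠ 0 := by
      intro h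
      rcases cardFactors_eq_zero_iff_eq_zero_or_one.1 h with h | h <;> omega
    obtain ⟨k, hk⟩ := Nat.exists_eq_succ_of_ne_zero hepos
    rw [hde, hc, Nat.add_sub_cancel_left, hk, Nat.succ_sub_one, pow_succ]
    ring
  rw [mul_add, hS]
  simp only [Nat.cast_one, pow_zero] at hB
  linear_combination -hB
end

section
/- Alternating logarithmic sum of factorization binomial coefficients: For every positive integer n that is not a prime number: ∑_{d | n} (n choose d)_f · (log d) · (-1)^{Ω(n/d)} = 0. -/
open Finset ArithmeticFunction

lemma aux_sum_mul {a b : ℕ} (hab : a.Coprime b) (F : ℕ → ℝ) :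
    ∑ d ∈ (a * b).divisors, F d = ∑ x ∈ a.divisors, ∑ y ∈ b.divisors, F (x * y) := by
  rw [Nat.divisors_mul, Finset.mul_def, Finset.sum_image hab.mul_injOn_divisors,
    Finset.sum_product]

lemma aux_fChoose_half {a b x y : ℕ} (ha : a ≠ 0) (hb : b ≠ 0) (hab : a.Coprime b)
    (hx : x ∣ a) (hy : y ∣ b) :
    ∏ p ∈ a.primeFactors, Nat.choose (padicValNat p (a * b)) (padicValNat p (x * y))
      = fChoose a x := by
  unfold fChoose
  refine Finset.prod_congr rfl fun p hp => ?_
  have hpp := Nat.prime_of_mem_primeFactors hp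
  have hpa := Nat.dvd_of_mem_primeFactors hp
  haveI : Fact p.Prime := ⟨hpp⟩
  have hpb : ¬ p ∣ b := fun h => hpp.one_lt.ne' (Nat.eq_one_of_dvd_coprimes hab hpa h)
  have hpy : ¬ p ∣ y := fun h => hpb (h.trans hy)
  have hx0 : x ≠ 0 := ne_zero_of_dvd_ne_zero ha hx
  have hy0 : y ≠ 0 := ne_zero_of_dvd_ne_zero hb hy
  rw [padicValNat.mul ha hb, padicValNat.mul hx0 hy0,
    padicValNat.eq_zero_of_not_dvd hpb, padicValNat.eq_zero_of_not_dvd hpy, add_zero, add_zero]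

lemma aux_fChoose_mul {a b x y : ℕ} (ha : a ≠ 0) (hb : b ≠ 0) (hab : a.Coprime b)
    (hx : x ∣ a) (hy : y ∣ b) :
    fChoose (a * b) (x * y) = fChoose a x * fChoose b y := by
  rw [← aux_fChoose_half ha hb hab hx hy, ← aux_fChoose_half hb ha hab.symm hy hx,
    mul_comm b a, mul_comm y x]
  unfold fChoose
  rw [hab.primeFactors_mul, Finset.prod_union hab.disjoint_primeFactors]

lemma aux_omega {a b x y : ℕ} (ha : a ≠ 0) (hb : b ≠ 0) (hx : x ∣ a) (hy : y ∣ b) :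
    (-1 : ℝ) ^ (cardFactors (a * b / (x * y)))
      = (-1 : ℝ) ^ (cardFactors (a / x)) * (-1 : ℝ) ^ (cardFactors (b / y)) := by
  rw [← Nat.div_mul_div_comm hx hy, cardFactors_mul, pow_add]
  · exact (Nat.div_pos (Nat.le_of_dvd (Nat.pos_of_ne_zero ha) hx)
      (Nat.pos_of_dvd_of_pos hx (Nat.pos_of_ne_zero ha))).ne'
  · exact (Nat.div_pos (Nat.le_of_dvd (Nat.pos_of_ne_zero hb) hy)
      (Nat.pos_of_dvd_of_pos hy (Nat.pos_of_ne_zero hb))).ne'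

/-- The alternating sum without logarithm. -/
noncomputable def auxS (n : ℕ) : ℝ :=
  ∑ d ∈ n.divisors, (fChoose n d : ℝ) * (-1 : ℝ) ^ (cardFactors (n / d))

/-- The alternating sum with logarithm. -/
noncomputable def auxT (n : ℕ) : ℝ :=
  ∑ d ∈ n.divisors, (fChoose n d : ℝ) * Real.log d * (-1 : ℝ) ^ (cardFactors (n / d))

lemma auxS_mul {a b : ℕ} (ha : a ≠ 0) (hb : b ≠ 0) (hab : a.Coprime b) :
    auxS (a * b) = auxS a * auxS b := by
  unfold auxS
  rw [aux_sum_mul hab, Finset.sum_mul_sum]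
  refine Finset.sum_congr rfl fun x hx => Finset.sum_congr rfl fun y hy => ?_
  have hx := Nat.dvd_of_mem_divisors hx
  have hy := Nat.dvd_of_mem_divisors hy
  rw [aux_fChoose_mul ha hb hab hx hy, aux_omega ha hb hx hy]
  push_cast
  ring

lemma auxT_mul {a b : ℕ} (ha : a ≠ 0) (hb : b ≠ 0) (hab : a.Coprime b) :
    auxT (a * b) = auxT a * auxS b + auxS a * auxT b := by
  unfold auxS auxT
  rw [aux_sum_mul hab, Finset.sum_mul_sum, Finset.sum_mul_sum, ← Finset.sum_add_distrib]
  refine Finset.sum_congr rfl fun x hx => ?_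
  rw [← Finset.sum_add_distrib]
  refine Finset.sum_congr rfl fun y hy => ?_
  have hx := Nat.dvd_of_mem_divisors hx
  have hy := Nat.dvd_of_mem_divisors hy
  have hx0 : (x : ℝ) ≠ 0 := Nat.cast_ne_zero.2 (ne_zero_of_dvd_ne_zero ha hx)
  have hy0 : (y : ℝ) ≠ 0 := Nat.cast_ne_zero.2 (ne_zero_of_dvd_ne_zero hb hy)
  rw [aux_fChoose_mul ha hb hab hx hy, aux_omega ha hb hx hy]
  push_cast
  rw [Real.log_mul hx0 hy0]
  ring

lemma aux_binom {k : ℕ} (hk : k ≠ 0) :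
    ∑ j ∈ Finset.range (k + 1), (k.choose j : ℝ) * (-1 : ℝ) ^ (k - j) = 0 := by
  have h := add_pow (1 : ℝ) (-1) k
  rw [add_neg_cancel, zero_pow hk] at h
  rw [h]
  exact Finset.sum_congr rfl fun j _ => by ring

lemma aux_binom' {k : ℕ} (hk : 2 ≤ k) :
    ∑ j ∈ Finset.range (k + 1), (k.choose j : ℝ) * j * (-1 : ℝ) ^ (k - j) = 0 := by
  obtain ⟨m, rfl⟩ : ∃ m, k = m + 1 := ⟨k - 1, by omega⟩
  rw [Finset.sum_range_succ']
  have h := aux_binom (k := m) (by omega)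
  have h2 : ∑ j ∈ Finset.range (m + 1), ((m + 1).choose (j + 1) : ℝ) * ((j + 1 : ℕ) : ℝ) *
      (-1 : ℝ) ^ (m + 1 - (j + 1)) =
      (m + 1 : ℝ) * ∑ j ∈ Finset.range (m + 1), (m.choose j : ℝ) * (-1 : ℝ) ^ (m - j) := by
    rw [Finset.mul_sum]
    refine Finset.sum_congr rfl fun j _ => ?_
    have := Nat.add_one_mul_choose_eq m j
    have h3 : ((m : ℝ) + 1) * m.choose j = (m + 1).choose (j + 1) * ((j + 1 : ℕ) : ℝ) := by
      exact_mod_cast this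
    rw [← h3, Nat.add_sub_add_right, mul_assoc]
  rw [h2, h]
  simp

lemma aux_fChoose_pp {p k j : ℕ} (hp : p.Prime) (hk : k ≠ 0) :
    fChoose (p ^ k) (p ^ j) = k.choose j := by
  haveI : Fact p.Prime := ⟨hp⟩
  unfold fChoose
  rw [Nat.primeFactors_prime_pow hk hp, Finset.prod_singleton, padicValNat.prime_pow,
    padicValNat.prime_pow]

lemma aux_omega_pp {p k j : ℕ} (hp : p.Prime) (hj : j ∈ Finset.range (k + 1)) :
    cardFactors (p ^ k / p ^ j) = k - j := by
  rw [Nat.pow_div (by simpa [Nat.lt_succ_iff] using hj) hp.pos, cardFactors_apply_prime_pow hp]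

lemma auxS_pp {p k : ℕ} (hp : p.Prime) (hk : k ≠ 0) : auxS (p ^ k) = 0 := by
  unfold auxS
  rw [Nat.sum_divisors_prime_pow hp, ← aux_binom hk]
  exact Finset.sum_congr rfl fun j hj => by rw [aux_fChoose_pp hp hk, aux_omega_pp hp hj]

lemma auxT_pp {p k : ℕ} (hp : p.Prime) (hk : 2 ≤ k) : auxT (p ^ k) = 0 := by
  unfold auxT
  rw [Nat.sum_divisors_prime_pow hp, ← mul_zero (Real.log p), ← aux_binom' hk, Finset.mul_sum]
  refine Finset.sum_congr rfl fun j hj => ?_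
  rw [aux_fChoose_pp hp (by omega), aux_omega_pp hp hj]
  push_cast
  rw [Real.log_pow]
  ring

lemma auxS_zero (n : ℕ) : 1 < n → auxS n = 0 := by
  induction n using Nat.recOnPosPrimePosCoprime with
  | prime_pow p k hp hk => exact fun _ => auxS_pp hp hk.ne'
  | zero => intro h; omega
  | one => intro h; omega
  | coprime a b ha hb hab iha ihb =>
    intro _
    rw [auxS_mul (by omega) (by omega) hab, iha ha, zero_mul]

/-- Alternating logarithmic sum of factorization binomial coefficients:
for `n` not prime, `∑_{d ∣ n} (n choose d)_f · ln d · (-1)^{Ω(n/d)} = 0`. -/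
theorem fChoose_alternating_log_sum (n : ℕ) (hn : 0 < n) (hnp : ¬ n.Prime) :
    ∑ d ∈ n.divisors,
        (fChoose n d : ℝ) * Real.log d * (-1 : ℝ) ^ (cardFactors (n / d)) = 0 := by
  change auxT n = 0
  induction n using Nat.recOnPosPrimePosCoprime with
  | prime_pow p k hp hk =>
    refine auxT_pp hp ?_
    by_contra h
    have : k = 1 := by omega
    subst this
    exact hnp (by simpa using hp)
  | zero => omega
  | one => simp [auxT]
  | coprime a b ha hb hab _ _ =>
    rw [auxT_mul (by omega) (by omega) hab, auxS_zero a ha, auxS_zero b hb]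
    simp
end

section
/- Generalized direct Abel-type identity for convolution families: Let s be a convolution family and for a positive integer m define u_m(x) := ∏_{p prime, p | m} s_{ν_p(m)}(x) (so u_1 ≡ 1). Then for every positive integer n and all real numbers φ, β: φ · (log n) · u_n(φ + β·log n) = (φ + β·log n) · ∑_{d | n} (n choose d)_f · (log d) · u_d(φ) · u_{n/d}(β·log n). -/
open Finset

open PowerSeries in
theorem single_abel (s : ℕ → ℝ → ℝ) (hs : ConvolutionFamily s) (n : ℕ) (φ ψ : ℝ) :
    φ * n * s n (φ + ψ) = (φ + ψ) * ∑ k ∈ range (n + 1),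
      (n.choose k : ℝ) * k * s k φ * s (n - k) ψ := by
  let S : ℝ → PowerSeries ℝ := fun x => PowerSeries.mk fun n => s n x / (n.factorial : ℝ)
  have hmul : ∀ x y, S (x + y) = S x * S y := by
    intro x y
    ext m
    simp only [S, coeff_mk, coeff_mul, hs.conv m x y, Finset.sum_div]
    rw [Finset.Nat.sum_antidiagonal_eq_sum_range_succ_mk]
    refine Finset.sum_congr rfl fun k hk => ?_
    have hk' : k ≤ m := by simpa [Nat.lt_succ_iff] using hk
    rw [Nat.cast_choose ℝ hk']
    have := Nat.factorial_ne_zero m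
    have := Nat.factorial_ne_zero k
    have := Nat.factorial_ne_zero (m - k)
    field_simp
  have h0 : S 0 = 1 := by
    ext m
    rcases Nat.eq_zero_or_pos m with rfl | hm
    · simp [S, hs.zeroth]
    · simp [S, hs.atZero m hm, coeff_one, hm.ne']
  have hinv : ∀ x, S x * S (-x) = 1 := fun x => by rw [← hmul, add_neg_cancel, h0]
  let L : ℝ → PowerSeries ℝ := fun x => derivative ℝ (S x) * S (-x)
  have hD : ∀ x y, derivative ℝ (S (x + y)) =
      S x * derivative ℝ (S y) + S y * derivative ℝ (S x) := by
    intro x y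
    rw [hmul, Derivation.leibniz, smul_eq_mul, smul_eq_mul]
  have hLadd : ∀ x y, L (x + y) = L x + L y := by
    intro x y
    simp only [L]
    rw [hD, neg_add, hmul (-x)]
    linear_combination (derivative ℝ (S y) * S (-y)) * hinv x +
      (derivative ℝ (S x) * S (-x)) * hinv y
  have hcont : ∀ m, Continuous (s m) := by
    intro m
    obtain ⟨p, hp⟩ := hs.isPoly m
    rw [show s m = fun x => p.eval x from funext hp]
    exact p.continuous
  have hL : ∀ x, L x = C x * L 1 := by
    intro x
    ext m
    have hc : Continuous fun x => coeff m (L x) := by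
      simp only [L, S, coeff_mul, coeff_derivative, coeff_mk]
      have := hcont
      fun_prop
    let f : ℝ →+ ℝ := AddMonoidHom.mk' (fun x => coeff m (L x)) (by
      intro a b; simp [hLadd])
    have h := (f.toRealLinearMap hc).map_smul x 1
    change coeff m (L (x • (1 : ℝ))) = x • coeff m (L 1) at h
    simpa using h
  have hDL : ∀ x, derivative ℝ (S x) = C x * L 1 * S x := by
    intro x
    rw [← hL]
    simp only [L]
    linear_combination -(derivative ℝ (S x)) * hinv x
  have key : C φ * derivative ℝ (S (φ + ψ)) = C (φ + ψ) * (derivative ℝ (S φ) * S ψ) := by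
    rw [hDL, hDL φ, hmul]; ring
  have key2 : C φ * (X * derivative ℝ (S (φ + ψ))) =
      C (φ + ψ) * ((X * derivative ℝ (S φ)) * S ψ) := by
    linear_combination X * key
  have hX : ∀ x m, coeff m (X * derivative ℝ (S x)) = m * (s m x / (m.factorial : ℝ)) := by
    intro x m
    cases m with
    | zero => simp
    | succ m => rw [coeff_succ_X_mul, coeff_derivative]; simp [S]; ring
  have h := congrArg (coeff n) key2
  rw [coeff_C_mul, coeff_C_mul, hX, coeff_mul,
    Finset.Nat.sum_antidiagonal_eq_sum_range_succ_mk] at h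
  simp only [hX] at h
  have hn := Nat.factorial_ne_zero n
  have h' : φ * n * s n (φ + ψ) = (n.factorial : ℝ) * (φ * (n * (s n (φ + ψ) / n.factorial))) := by
    field_simp
  rw [h', h, mul_left_comm, Finset.mul_sum]
  congr 1
  refine Finset.sum_congr rfl fun k hk => ?_
  have hk' : k ≤ n := by simpa [Nat.lt_succ_iff] using hk
  rw [Nat.cast_choose ℝ hk']
  have := Nat.factorial_ne_zero k
  have := Nat.factorial_ne_zero (n - k)
  simp only [S, coeff_mk]
  field_simp

theorem pv_mul_left {a b p : ℕ} (hab : a.Coprime b) (hb : b ≠ 0) (hp : p ∈ a.primeFactors)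
    {d e : ℕ} (hd : d ∣ a) (he : e ∣ b) : padicValNat p (d * e) = padicValNat p d := by
  have hpp := Nat.prime_of_mem_primeFactors hp
  have := Fact.mk hpp
  have ha : a ≠ 0 := (Nat.mem_primeFactors.1 hp).2.2
  have hpe : ¬ p ∣ e := fun h => hpp.one_lt.ne'
    (Nat.eq_one_of_dvd_coprimes hab (Nat.dvd_of_mem_primeFactors hp) (h.trans he))
  rw [padicValNat.mul (ne_zero_of_dvd_ne_zero ha hd) (ne_zero_of_dvd_ne_zero hb he),
    padicValNat.eq_zero_of_not_dvd hpe, add_zero]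

theorem prod_pf_mul {a b : ℕ} (hab : a.Coprime b) (ha : a ≠ 0) (hb : b ≠ 0)
    {d e : ℕ} (hd : d ∣ a) (he : e ∣ b) {M : Type*} [CommMonoid M] (F : ℕ → ℕ → M) :
    ∏ p ∈ (a * b).primeFactors, F (padicValNat p (a * b)) (padicValNat p (d * e)) =
      (∏ p ∈ a.primeFactors, F (padicValNat p a) (padicValNat p d)) *
      ∏ p ∈ b.primeFactors, F (padicValNat p b) (padicValNat p e) := by
  rw [hab.primeFactors_mul, Finset.prod_union hab.disjoint_primeFactors]
  congr 1
  · refine Finset.prod_congr rfl fun p hp => ?_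
    rw [pv_mul_left hab hb hp hd he, pv_mul_left hab hb hp dvd_rfl dvd_rfl]
  · refine Finset.prod_congr rfl fun p hp => ?_
    rw [mul_comm a b, mul_comm d e, pv_mul_left hab.symm ha hp he hd,
      pv_mul_left hab.symm ha hp dvd_rfl dvd_rfl]

theorem sum_div_coprime {a b : ℕ} (hab : a.Coprime b) (F : ℕ → ℝ) :
    ∑ d ∈ (a * b).divisors, F d = ∑ d ∈ a.divisors, ∑ e ∈ b.divisors, F (d * e) := by
  rw [← Finset.sum_product', Nat.divisors_mul, Finset.mul_def,
    Finset.sum_image hab.mul_injOn_divisors]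

theorem abel_aux (s : ℕ → ℝ → ℝ) (hs : ConvolutionFamily s)
    (u : ℕ → ℝ → ℝ)
    (hu : ∀ (m : ℕ) (x : ℝ), u m x = ∏ p ∈ m.primeFactors, s (padicValNat p m) x)
    (φ ψ : ℝ) (n : ℕ) : n ≠ 0 →
    u n (φ + ψ) = ∑ d ∈ n.divisors, (fChoose n d : ℝ) * u d φ * u (n / d) ψ ∧
    φ * Real.log n * u n (φ + ψ) = (φ + ψ) *
      ∑ d ∈ n.divisors, (fChoose n d : ℝ) * Real.log d * u d φ * u (n / d) ψ := by
  have upp : ∀ p k : ℕ, p.Prime → ∀ x, u (p ^ k) x = s k x := by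
    intro p k hp x
    have := Fact.mk hp
    rcases Nat.eq_zero_or_pos k with rfl | hk
    · simp [hu, hs.zeroth]
    · rw [hu, Nat.primeFactors_prime_pow hk.ne' hp]
      simp
  have umul : ∀ a b : ℕ, a.Coprime b → a ≠ 0 → b ≠ 0 → ∀ x, u (a * b) x = u a x * u b x := by
    intro a b hab ha hb x
    simp only [hu]
    exact prod_pf_mul hab ha hb dvd_rfl dvd_rfl (fun i _ => s i x)
  induction n using Nat.recOnPrimeCoprime with
  | zero => intro h; exact absurd rfl h
  | prime_pow p k hp =>
    intro _
    have := Fact.mk hp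
    have hf : ∀ j ∈ range (k + 1), fChoose (p ^ k) (p ^ j) = k.choose j := by
      intro j hj
      rcases Nat.eq_zero_or_pos k with rfl | hk
      · have : j = 0 := by simpa using hj
        simp [fChoose, this]
      · rw [fChoose, Nat.primeFactors_prime_pow hk.ne' hp]
        simp
    have hd : ∀ j ∈ range (k + 1), p ^ k / p ^ j = p ^ (k - j) := by
      intro j hj
      exact Nat.pow_div (by simpa [Nat.lt_succ_iff] using hj) hp.pos
    rw [Nat.sum_divisors_prime_pow hp, Nat.sum_divisors_prime_pow hp, upp p k hp]
    constructor
    · rw [hs.conv]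
      refine Finset.sum_congr rfl fun j hj => ?_
      rw [hf j hj, hd j hj, upp p _ hp, upp p _ hp]
    · have h := single_abel s hs k φ ψ
      rw [Nat.cast_pow, Real.log_pow]
      have h2 : ∑ j ∈ range (k + 1), (fChoose (p ^ k) (p ^ j) : ℝ) * Real.log ((p ^ j : ℕ) : ℝ) *
          u (p ^ j) φ * u (p ^ k / p ^ j) ψ = Real.log p * ∑ j ∈ range (k + 1),
          (k.choose j : ℝ) * j * s j φ * s (k - j) ψ := by
        rw [Finset.mul_sum]
        refine Finset.sum_congr rfl fun j hj => ?_
        rw [hf j hj, hd j hj, upp p _ hp, upp p _ hp, Nat.cast_pow, Real.log_pow]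
        ring
      rw [h2]
      linear_combination Real.log p * h
  | coprime a b ha1 hb1 hab iha ihb =>
    intro _
    have ha : a ≠ 0 := by omega
    have hb : b ≠ 0 := by omega
    obtain ⟨A1, A2⟩ := iha ha
    obtain ⟨B1, B2⟩ := ihb hb
    have hterm : ∀ d ∈ a.divisors, ∀ e ∈ b.divisors,
        (fChoose (a * b) (d * e) : ℝ) = fChoose a d * fChoose b e ∧
        u (d * e) φ = u d φ * u e φ ∧
        u (a * b / (d * e)) ψ = u (a / d) ψ * u (b / e) ψ ∧
        Real.log ((d * e : ℕ) : ℝ) = Real.log d + Real.log e := by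
      intro d hd e he
      have hda := Nat.dvd_of_mem_divisors hd
      have heb := Nat.dvd_of_mem_divisors he
      have hd0 := ne_zero_of_dvd_ne_zero ha hda
      have he0 := ne_zero_of_dvd_ne_zero hb heb
      refine ⟨?_, ?_, ?_, ?_⟩
      · rw [← Nat.cast_mul]
        congr 1
        exact prod_pf_mul hab ha hb hda heb Nat.choose
      · exact umul d e (hab.of_dvd hda heb) hd0 he0 φ
      · rw [← Nat.div_mul_div_comm hda heb]
        exact umul _ _ (hab.of_dvd (Nat.div_dvd_of_dvd hda) (Nat.div_dvd_of_dvd heb))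
          (ne_zero_of_dvd_ne_zero ha (Nat.div_dvd_of_dvd hda))
          (ne_zero_of_dvd_ne_zero hb (Nat.div_dvd_of_dvd heb)) ψ
      · rw [Nat.cast_mul, Real.log_mul (by exact_mod_cast hd0) (by exact_mod_cast he0)]
    rw [umul a b hab ha hb, sum_div_coprime hab, sum_div_coprime hab]
    constructor
    · rw [A1, B1, Finset.sum_mul_sum]
      refine Finset.sum_congr rfl fun d hd => Finset.sum_congr rfl fun e he => ?_
      obtain ⟨h1, h2, h3, h4⟩ := hterm d hd e he
      rw [h1, h2, h3]
      ring
    · have hS : ∑ d ∈ a.divisors, ∑ e ∈ b.divisors,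
          (fChoose (a * b) (d * e) : ℝ) * Real.log ((d * e : ℕ) : ℝ) * u (d * e) φ *
            u (a * b / (d * e)) ψ =
          (∑ d ∈ a.divisors, (fChoose a d : ℝ) * Real.log d * u d φ * u (a / d) ψ) *
            u b (φ + ψ) + u a (φ + ψ) *
          (∑ d ∈ b.divisors, (fChoose b d : ℝ) * Real.log d * u d φ * u (b / d) ψ) := by
        rw [A1, B1, Finset.sum_mul_sum, Finset.sum_mul_sum, ← Finset.sum_add_distrib]
        refine Finset.sum_congr rfl fun d hd => ?_
        rw [← Finset.sum_add_distrib]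
        refine Finset.sum_congr rfl fun e he => ?_
        obtain ⟨h1, h2, h3, h4⟩ := hterm d hd e he
        rw [h1, h2, h3, h4]
        ring
      rw [hS, Nat.cast_mul, Real.log_mul (by exact_mod_cast ha) (by exact_mod_cast hb)]
      linear_combination u b (φ + ψ) * A2 + u a (φ + ψ) * B2

/-- Generalized direct Abel-type identity for convolution families:
with `u_m(x) = ∏_{p ∣ m} s_{ν_p(m)}(x)`,
`φ·ln n·u_n(φ+β ln n) = (φ+β ln n)·∑_{d∣n} (n choose d)_f · ln d · u_d(φ) ·
u_{n/d}(β ln n)`. -/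
theorem generalized_direct_abel (s : ℕ → ℝ → ℝ) (hs : ConvolutionFamily s)
    (u : ℕ → ℝ → ℝ)
    (hu : ∀ (m : ℕ) (x : ℝ), u m x = ∏ p ∈ m.primeFactors, s (padicValNat p m) x)
    (n : ℕ) (hn : 0 < n) (φ β : ℝ) :
    φ * Real.log n * u n (φ + β * Real.log n) =
      (φ + β * Real.log n) *
        ∑ d ∈ n.divisors,
          (fChoose n d : ℝ) * Real.log d * u d φ * u (n / d) (β * Real.log n) := by
  exact (abel_aux s hs u hu φ (β * Real.log n) n hn.ne').2
end

section
/- Generalized inverse Abel-type identity for convolution families: Let s be a convolution family and for a positive integer m define u_m(x) := ∏_{p prime, p | m} s_{ν_p(m)}(x) (so u_1 ≡ 1). Let n be a positive integer and let φ, β ∈ ℝ satisfy φ + β·log d ≠ 0 for every divisor d of n (in particular φ ≠ 0). Then u_n(φ) = ∑_{d | n} (n choose d)_f · (φ/(φ + β·log d)) · u_d(φ + β·log d) · u_{n/d}(-β·log d). -/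
open Finset

section

open ArithmeticFunction

noncomputable def vv (s : ℕ → ℝ → ℝ) (x : ℝ) : ArithmeticFunction ℝ :=
  ⟨fun n => if n = 0 then 0 else n.factorization.prod (fun _ k => s k x / (k.factorial : ℝ)), by simp⟩

theorem vv_apply (s : ℕ → ℝ → ℝ) (x : ℝ) {n : ℕ} (hn : n ≠ 0) :
    vv s x n = n.factorization.prod (fun _ k => s k x / (k.factorial : ℝ)) := by
  simp [vv, hn]

theorem vv_mult {s : ℕ → ℝ → ℝ} (x : ℝ) :
    (vv s x).IsMultiplicative := by
  rw [IsMultiplicative.iff_ne_zero]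
  refine ⟨by simp [vv], ?_⟩
  intro m n hm hn h
  rw [vv_apply s x hm, vv_apply s x hn, vv_apply s x (mul_ne_zero hm hn),
    Nat.factorization_mul_of_coprime h]
  exact Finsupp.prod_add_index_of_disjoint (h.disjoint_primeFactors) _

theorem vv_pp {s : ℕ → ℝ → ℝ} (hs : ConvolutionFamily s) (x : ℝ) {p : ℕ} (hp : p.Prime) (k : ℕ) :
    vv s x (p ^ k) = s k x / (k.factorial : ℝ) := by
  rw [vv_apply s x (pow_ne_zero _ hp.ne_zero), hp.factorization_pow,
    Finsupp.prod_single_index (by simp [hs.zeroth])]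

theorem vv_add {s : ℕ → ℝ → ℝ} (hs : ConvolutionFamily s) (x y : ℝ) :
    vv s (x + y) = vv s x * vv s y := by
  rw [IsMultiplicative.eq_iff_eq_on_prime_powers _ (vv_mult _) _ ((vv_mult _).mul (vv_mult _))]
  intro p k hp
  rw [vv_pp hs _ hp, ArithmeticFunction.mul_apply,
    Nat.sum_divisorsAntidiagonal (f := fun a b => vv s x a * vv s y b),
    Nat.sum_divisors_prime_pow hp, hs.conv, Finset.sum_div]
  refine Finset.sum_congr rfl fun i hi => ?_
  have hik : i ≤ k := by simpa [Nat.lt_succ_iff] using hi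
  rw [Nat.pow_div hik hp.pos, vv_pp hs _ hp, vv_pp hs _ hp, Nat.cast_choose ℝ hik]
  field_simp

theorem vv_zero {s : ℕ → ℝ → ℝ} (hs : ConvolutionFamily s) : vv s 0 = 1 := by
  rw [IsMultiplicative.eq_iff_eq_on_prime_powers _ (vv_mult _) _ isMultiplicative_one]
  intro p k hp
  rw [vv_pp hs _ hp]
  rcases Nat.eq_zero_or_pos k with rfl | hk
  · simp [hs.zeroth]
  · rw [hs.atZero k hk, one_apply_ne (by simp [hp.ne_one, hk.ne'])]
    simp

/-- pointwise polynomial of bounded degree -/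
def PD (q : ℕ) (g : ℝ → ArithmeticFunction ℝ) : Prop :=
  ∀ n, ∃ P : Polynomial ℝ, P.natDegree ≤ q ∧ ∀ x, g x n = P.eval x

theorem PD.add {q : ℕ} {g h : ℝ → ArithmeticFunction ℝ} (hg : PD q g) (hh : PD q h) :
    PD q (fun x => g x + h x) := by
  intro n
  obtain ⟨P, hP, hP'⟩ := hg n
  obtain ⟨Q, hQ, hQ'⟩ := hh n
  exact ⟨P + Q, Polynomial.natDegree_add_le_of_degree_le hP hQ, fun x => by simp [hP', hQ']⟩

theorem PD.mono {q r : ℕ} (h : q ≤ r) {g : ℝ → ArithmeticFunction ℝ} (hg : PD q g) : PD r g := by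
  intro n
  obtain ⟨P, hP, hP'⟩ := hg n
  exact ⟨P, hP.trans h, hP'⟩

theorem PD.pmul {q : ℕ} {g : ℝ → ArithmeticFunction ℝ} (hg : PD q g) (a : ArithmeticFunction ℝ) :
    PD q (fun x => a.pmul (g x)) := by
  intro n
  obtain ⟨P, hP, hP'⟩ := hg n
  exact ⟨Polynomial.C (a n) * P, (Polynomial.natDegree_C_mul_le _ _).trans hP,
    fun x => by simp [hP']⟩

theorem PD.mul {q r : ℕ} {g h : ℝ → ArithmeticFunction ℝ} (hg : PD q g) (hh : PD r h) :
    PD (q + r) (fun x => g x * h x) := by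
  intro n
  choose P hP hP' using hg
  choose Q hQ hQ' using hh
  refine ⟨∑ a ∈ n.divisorsAntidiagonal, P a.1 * Q a.2, ?_, fun x => ?_⟩
  · exact Polynomial.natDegree_sum_le_of_forall_le _ _ fun a _ =>
      Polynomial.natDegree_mul_le_of_le (hP _) (hQ _)
  · simp [ArithmeticFunction.mul_apply, Polynomial.eval_finsetSum, hP', hQ']

theorem vv_poly {s : ℕ → ℝ → ℝ} (hs : ConvolutionFamily s) (n : ℕ) :
    ∃ P : Polynomial ℝ, ∀ x, vv s x n = P.eval x := by
  rcases eq_or_ne n 0 with rfl | hn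
  · exact ⟨0, by simp⟩
  choose p hp using hs.isPoly
  refine ⟨n.factorization.prod fun _ k => p k * Polynomial.C (k.factorial : ℝ)⁻¹, fun x => ?_⟩
  rw [vv_apply s x hn]
  simp only [Finsupp.prod, Polynomial.eval_prod, Polynomial.eval_mul, Polynomial.eval_C, hp,
    div_eq_mul_inv]

/-- the additive weight -/
noncomputable def bl (β : ℝ) : ArithmeticFunction ℝ := ⟨fun n => β * Real.log n, by simp⟩

theorem bl_apply (β : ℝ) (n : ℕ) : bl β n = β * Real.log n := rfl

theorem D_mul (β : ℝ) (f g : ArithmeticFunction ℝ) :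
    (bl β).pmul (f * g) = (bl β).pmul f * g + f * (bl β).pmul g := by
  ext n
  simp only [pmul_apply, ArithmeticFunction.mul_apply, ArithmeticFunction.add_apply, Finset.mul_sum,
    ← Finset.sum_add_distrib, bl_apply]
  refine Finset.sum_congr rfl fun a ha => ?_
  obtain ⟨rfl, h0⟩ := Nat.mem_divisorsAntidiagonal.1 ha
  rw [Nat.cast_mul, Real.log_mul (by simpa using left_ne_zero_of_mul h0)
    (by simpa using right_ne_zero_of_mul h0)]
  ring

theorem D_one (β : ℝ) : (bl β).pmul 1 = 0 := by
  ext n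
  rcases eq_or_ne n 1 with rfl | h
  · simp [bl_apply]
  · simp [one_apply_ne h]

theorem additive_deg (P : Polynomial ℝ) (h : ∀ x y, P.eval (x + y) = P.eval x + P.eval y) :
    P.natDegree ≤ 1 := by
  have h0 : P.eval 0 = 0 := by have := h 0 0; simp at this; exact this
  have hk : ∀ k : ℕ, P.eval (k : ℝ) = k * P.eval 1 := by
    intro k
    induction k with
    | zero => simp [h0]
    | succ k ih => push_cast; rw [h, ih]; ring
  have : P = Polynomial.C (P.eval 1) * Polynomial.X := by
    apply Polynomial.eq_of_infinite_eval_eq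
    refine Set.Infinite.mono ?_ (Set.infinite_range_of_injective (Nat.cast_injective (R := ℝ)))
    rintro _ ⟨k, rfl⟩
    simp only [Set.mem_ofPred_eq, Polynomial.eval_mul, Polynomial.eval_C, Polynomial.eval_X]
    rw [hk, mul_comm]
  rw [this]
  exact (Polynomial.natDegree_C_mul_le _ _).trans Polynomial.natDegree_X_le

theorem vv_neg {s : ℕ → ℝ → ℝ} (hs : ConvolutionFamily s) (x : ℝ) : vv s x * vv s (-x) = 1 := by
  rw [← vv_add hs, add_neg_cancel, vv_zero hs]

theorem PD_E1 {s : ℕ → ℝ → ℝ} (hs : ConvolutionFamily s) (β : ℝ) :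
    PD 1 (fun x => (bl β).pmul (vv s x) * vv s (-x)) := by
  intro n
  choose P hP using vv_poly hs
  have key : ∀ x, ((bl β).pmul (vv s x) * vv s (-x)) n =
      (∑ a ∈ n.divisorsAntidiagonal, Polynomial.C (bl β a.1) * P a.1 *
        (P a.2).comp (-Polynomial.X)).eval x := by
    intro x
    simp [ArithmeticFunction.mul_apply, Polynomial.eval_finsetSum, hP]
  refine ⟨_, additive_deg _ ?_, key⟩
  intro x y
  rw [← key, ← key, ← key, ← ArithmeticFunction.add_apply]
  congr 1
  rw [neg_add, vv_add hs, vv_add hs, D_mul]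
  have hx := vv_neg hs x
  have hy := vv_neg hs y
  linear_combination ((bl β).pmul (vv s x) * vv s (-x)) * hy + ((bl β).pmul (vv s y) * vv s (-y)) * hx

noncomputable def wt (y β : ℝ) (q : ℕ) : ArithmeticFunction ℝ :=
  ⟨fun n => if n = 0 then 0 else (y + β * Real.log n) ^ q, by simp⟩

theorem wt_apply (y β : ℝ) (q : ℕ) {n : ℕ} (hn : n ≠ 0) :
    wt y β q n = (y + β * Real.log n) ^ q := by
  simp [wt, hn]

theorem PD_E {s : ℕ → ℝ → ℝ} (hs : ConvolutionFamily s) (y β : ℝ) (q : ℕ) :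
    PD q (fun x => (wt y β q).pmul (vv s x) * vv s (-x)) := by
  induction q with
  | zero =>
    intro n
    refine ⟨Polynomial.C ((1 : ArithmeticFunction ℝ) n), by simp, fun x => ?_⟩
    have : (wt y β 0).pmul (vv s x) = vv s x := by
      ext m
      rcases eq_or_ne m 0 with rfl | hm
      · simp
      · simp [wt_apply, hm]
    simp only [this, vv_neg hs, Polynomial.eval_C]
  | succ q ih =>
    have h1 := ((ih.pmul (wt y 0 1)).add
      (ih.pmul (bl β))).mono (Nat.le_succ q)
    have h2 := h1.add (ih.mul (PD_E1 hs β))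
    convert h2 using 2 with x
    have hM : (wt y β (q+1)).pmul (vv s x) = y • (wt y β q).pmul (vv s x) +
        (bl β).pmul ((wt y β q).pmul (vv s x)) := by
      ext m
      rcases eq_or_ne m 0 with rfl | hm
      · simp
      · simp [wt_apply, hm, bl_apply]; ring
    have hy : ∀ g : ArithmeticFunction ℝ, (wt y 0 1).pmul g = y • g := by
      intro g
      ext m
      rcases eq_or_ne m 0 with rfl | hm
      · simp
      · simp [wt_apply, hm]
    rw [hM, hy, D_mul, add_mul, smul_mul_assoc, add_assoc, add_assoc]
    congr 2
    have hx := vv_neg hs x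
    have hD := D_mul β (vv s x) (vv s (-x))
    rw [hx, D_one] at hD
    generalize (wt y β q).pmul (vv s x) = A at *
    generalize (bl β).pmul (vv s (-x)) = B at *
    generalize (bl β).pmul (vv s x) = C at *
    linear_combination (A * vv s (-x)) * hD + A * B * hx

theorem Z_zero {s : ℕ → ℝ → ℝ} (hs : ConvolutionFamily s) (φ β : ℝ) {n : ℕ} (hn1 : n ≠ 1)
    (hne : ∀ d ∈ n.divisors, φ + β * Real.log d ≠ 0) :
    ∑ a ∈ n.divisorsAntidiagonal, (φ / (φ + β * Real.log a.1)) *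
      (vv s (φ + β * Real.log a.1) a.1 * vv s (-(φ + β * Real.log a.1)) a.2) = 0 := by
  choose P hP using vv_poly hs
  let g : ℕ × ℕ → Polynomial ℝ := fun a => P a.1 * (P a.2).comp (-Polynomial.X)
  have hg : ∀ a x, vv s x a.1 * vv s (-x) a.2 = (g a).eval x := by
    intro a x
    simp [g, hP]
  have hg0 : ∀ a ∈ n.divisorsAntidiagonal, (g a).coeff 0 = 0 := by
    intro a ha
    rw [Polynomial.coeff_zero_eq_eval_zero, ← hg, neg_zero, vv_zero hs]
    obtain ⟨h, -⟩ := Nat.mem_divisorsAntidiagonal.1 ha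
    by_cases h1 : a.1 = 1
    · have h2 : a.2 ≠ 1 := by
        intro h2
        apply hn1
        rw [← h, h1, h2]
      rw [one_apply_ne h2, mul_zero]
    · rw [one_apply_ne h1, zero_mul]
  -- vanishing of coefficients
  have hc : ∀ q : ℕ, ∑ a ∈ n.divisorsAntidiagonal,
      (φ + β * Real.log a.1) ^ q * (g a).coeff (q + 1) = 0 := by
    intro q
    obtain ⟨Q, hQ, hQ'⟩ := PD_E hs φ β q n
    have hQe : Q = ∑ a ∈ n.divisorsAntidiagonal,
        Polynomial.C ((φ + β * Real.log a.1) ^ q) * g a := by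
      apply Polynomial.funext
      intro x
      rw [← hQ', ArithmeticFunction.mul_apply, Polynomial.eval_finsetSum]
      refine Finset.sum_congr rfl fun a ha => ?_
      rw [pmul_apply, wt_apply _ _ _ (Nat.left_ne_zero_of_mem_divisorsAntidiagonal ha),
        Polynomial.eval_mul, Polynomial.eval_C, ← hg, mul_assoc]
    have h0 : Q.coeff (q + 1) = 0 := Polynomial.coeff_eq_zero_of_natDegree_lt (by omega)
    rw [hQe, Polynomial.finsetSum_coeff] at h0
    simpa only [Polynomial.coeff_C_mul] using h0
  let R := n.divisorsAntidiagonal.sup fun a => (g a).natDegree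
  have hterm : ∀ a ∈ n.divisorsAntidiagonal, (φ / (φ + β * Real.log a.1)) *
      (vv s (φ + β * Real.log a.1) a.1 * vv s (-(φ + β * Real.log a.1)) a.2) =
      ∑ q ∈ Finset.range R, φ * ((φ + β * Real.log a.1) ^ q * (g a).coeff (q + 1)) := by
    intro a ha
    have hx := hne a.1 (Nat.fst_mem_divisors_of_mem_antidiagonal ha)
    rw [hg, Polynomial.eval_eq_sum_range' (n := R + 1)
      (Nat.lt_succ_of_le (Finset.le_sup (f := fun a => (g a).natDegree) ha)),
      Finset.sum_range_succ', hg0 a ha, zero_mul, add_zero, Finset.mul_sum]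
    refine Finset.sum_congr rfl fun q _ => ?_
    field_simp
    ring
  rw [Finset.sum_congr rfl hterm, Finset.sum_comm]
  refine Finset.sum_eq_zero fun q _ => ?_
  rw [← Finset.mul_sum, hc, mul_zero]

theorem swap_sum (n : ℕ) (F : ℕ → ℕ → ℕ → ℝ) :
    ∑ a ∈ n.divisorsAntidiagonal, ∑ b ∈ a.2.divisorsAntidiagonal, F a.1 b.1 b.2 =
    ∑ a ∈ n.divisorsAntidiagonal, ∑ b ∈ a.2.divisorsAntidiagonal, F b.1 a.1 b.2 := by
  rw [Finset.sum_sigma', Finset.sum_sigma']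
  refine Finset.sum_nbij' (fun t => ⟨(t.2.1, t.1.1 * t.2.2), (t.1.1, t.2.2)⟩)
    (fun t => ⟨(t.2.1, t.1.1 * t.2.2), (t.1.1, t.2.2)⟩) ?_ ?_ ?_ ?_ ?_
  · rintro ⟨⟨a, b⟩, ⟨c, d⟩⟩ h
    simp only [Finset.mem_sigma, Nat.mem_divisorsAntidiagonal] at h ⊢
    obtain ⟨⟨rfl, h0⟩, rfl, h1⟩ := h
    simp only [ne_eq, mul_eq_zero, not_or] at h0 h1 ⊢
    exact ⟨⟨by ring, h0⟩, trivial, h0.1, h1.2⟩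
  · rintro ⟨⟨a, b⟩, ⟨c, d⟩⟩ h
    simp only [Finset.mem_sigma, Nat.mem_divisorsAntidiagonal] at h ⊢
    obtain ⟨⟨rfl, h0⟩, rfl, h1⟩ := h
    simp only [ne_eq, mul_eq_zero, not_or] at h0 h1 ⊢
    exact ⟨⟨by ring, h0⟩, trivial, h0.1, h1.2⟩
  · rintro ⟨⟨a, b⟩, ⟨c, d⟩⟩ h
    simp only [Finset.mem_sigma, Nat.mem_divisorsAntidiagonal] at h
    obtain ⟨⟨rfl, h0⟩, rfl, h1⟩ := h
    rfl
  · rintro ⟨⟨a, b⟩, ⟨c, d⟩⟩ h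
    simp only [Finset.mem_sigma, Nat.mem_divisorsAntidiagonal] at h
    obtain ⟨⟨rfl, h0⟩, rfl, h1⟩ := h
    rfl
  · rintro ⟨⟨a, b⟩, ⟨c, d⟩⟩ h
    rfl

theorem main_vv {s : ℕ → ℝ → ℝ} (hs : ConvolutionFamily s) (φ β : ℝ) {n : ℕ} (hn : n ≠ 0)
    (hne : ∀ d ∈ n.divisors, φ + β * Real.log d ≠ 0) :
    vv s φ n = ∑ a ∈ n.divisorsAntidiagonal, (φ / (φ + β * Real.log a.1)) *
      vv s (φ + β * Real.log a.1) a.1 * vv s (-(β * Real.log a.1)) a.2 := by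
  have h1 : ∀ a ∈ n.divisorsAntidiagonal, (φ / (φ + β * Real.log a.1)) *
      vv s (φ + β * Real.log a.1) a.1 * vv s (-(β * Real.log a.1)) a.2 =
      ∑ b ∈ a.2.divisorsAntidiagonal, vv s φ b.1 * ((φ / (φ + β * Real.log a.1)) *
      (vv s (φ + β * Real.log a.1) a.1 * vv s (-(φ + β * Real.log a.1)) b.2)) := by
    intro a _
    have : -(β * Real.log a.1) = φ + -(φ + β * Real.log a.1) := by ring
    rw [this, vv_add hs φ (-(φ + β * Real.log a.1)), ArithmeticFunction.mul_apply, Finset.mul_sum]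
    refine Finset.sum_congr rfl fun b _ => by ring
  rw [Finset.sum_congr rfl h1, swap_sum n (fun d j l => vv s φ j * ((φ / (φ + β * Real.log d)) *
      (vv s (φ + β * Real.log d) d * vv s (-(φ + β * Real.log d)) l)))]
  rw [Finset.sum_eq_single (n, 1)]
  · have h0 := hne 1 (by simp [hn])
    simp only [Nat.cast_one, Real.log_one, mul_zero, add_zero] at h0
    simp [div_self h0, (vv_mult _).map_one]
  · rintro ⟨d, e⟩ ha hne'
    obtain ⟨h, -⟩ := Nat.mem_divisorsAntidiagonal.1 ha
    have he : e ≠ 1 := by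
      rintro rfl
      simp at h
      simp [h] at hne'
    rw [← Finset.mul_sum]
    simp only
    rw [Z_zero hs φ β he, mul_zero]
    intro d' hd'
    apply hne
    exact Nat.mem_divisors.2 ⟨(Nat.dvd_of_mem_divisors hd').trans ⟨d, by rw [← h, mul_comm]⟩, hn⟩
  · simp [hn]

/-- `f(n)` -/
noncomputable def ff (n : ℕ) : ℝ := ∏ p ∈ n.primeFactors, ((padicValNat p n).factorial : ℝ)

theorem ff_ne (n : ℕ) : ff n ≠ 0 :=
  Finset.prod_ne_zero_iff.2 fun p _ => by exact_mod_cast Nat.factorial_ne_zero _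

theorem vv_eq (s : ℕ → ℝ → ℝ) (x : ℝ) {n : ℕ} (hn : n ≠ 0) :
    ∏ p ∈ n.primeFactors, s (padicValNat p n) x = ff n * vv s x n := by
  rw [vv_apply s x hn, ff, Finsupp.prod, Nat.support_factorization, ← Finset.prod_mul_distrib]
  refine Finset.prod_congr rfl fun p hp => ?_
  rw [Nat.factorization_def _ (Nat.prime_of_mem_primeFactors hp)]
  field_simp

theorem ff_ext {n d : ℕ} (hn : n ≠ 0) (hd : d ∣ n) :
    ff d = ∏ p ∈ n.primeFactors, ((padicValNat p d).factorial : ℝ) := by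
  refine Finset.prod_subset (Nat.primeFactors_mono hd hn) fun p hp hp' => ?_
  have hpp := Nat.prime_of_mem_primeFactors hp
  rw [← Nat.factorization_def _ hpp, Finsupp.notMem_support_iff.1 hp']
  simp

theorem fChoose_mul (a b : ℕ) (h : a * b ≠ 0) :
    (fChoose (a * b) a : ℝ) * ff a * ff b = ff (a * b) := by
  rw [ff_ext h (Dvd.intro _ rfl), ff_ext h (Dvd.intro_left _ rfl), ff, fChoose, Nat.cast_prod,
    ← Finset.prod_mul_distrib, ← Finset.prod_mul_distrib]
  refine Finset.prod_congr rfl fun p hp => ?_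
  have : Fact p.Prime := ⟨Nat.prime_of_mem_primeFactors hp⟩
  rw [padicValNat.mul (left_ne_zero_of_mul h) (right_ne_zero_of_mul h)]
  have h2 := Nat.choose_mul_factorial_mul_factorial
    (Nat.le_add_right (padicValNat p a) (padicValNat p b))
  rw [Nat.add_sub_cancel_left] at h2
  exact_mod_cast h2

end

/-- Generalized inverse Abel-type identity for convolution families:
with `u_m(x) = ∏_{p ∣ m} s_{ν_p(m)}(x)`,
`u_n(φ) = ∑_{d∣n} (n choose d)_f · (φ/(φ+β ln d)) · u_d(φ+β ln d) ·
u_{n/d}(-β ln d)`. -/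
theorem generalized_inverse_abel (s : ℕ → ℝ → ℝ) (hs : ConvolutionFamily s)
    (u : ℕ → ℝ → ℝ)
    (hu : ∀ (m : ℕ) (x : ℝ), u m x = ∏ p ∈ m.primeFactors, s (padicValNat p m) x)
    (n : ℕ) (hn : 0 < n) (φ β : ℝ)
    (hne : ∀ d ∈ n.divisors, φ + β * Real.log d ≠ 0) :
    u n φ =
      ∑ d ∈ n.divisors,
        (fChoose n d : ℝ) * (φ / (φ + β * Real.log d)) * u d (φ + β * Real.log d) *
          u (n / d) (-(β * Real.log d)) := by
  rw [← Nat.sum_divisorsAntidiagonal (f := fun d e => (fChoose n d : ℝ) *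
    (φ / (φ + β * Real.log d)) * u d (φ + β * Real.log d) * u e (-(β * Real.log d)))]
  rw [hu, vv_eq s φ hn.ne', main_vv hs φ β hn.ne' hne, Finset.mul_sum]
  refine Finset.sum_congr rfl fun a ha => ?_
  obtain ⟨h, h0⟩ := Nat.mem_divisorsAntidiagonal.1 ha
  rw [hu, hu, vv_eq s _ (Nat.left_ne_zero_of_mem_divisorsAntidiagonal ha),
    vv_eq s _ (Nat.right_ne_zero_of_mem_divisorsAntidiagonal ha)]
  have := fChoose_mul a.1 a.2 (by rw [h]; exact h0)
  rw [h] at this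
  rw [← this]
  ring
end
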